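/- arXiv:1712.04208 — 2 statements merged into one kernel-verified Lean document; each statement's English description precedes it below -/
import Mathlib

section
/- Let a ≥ 0, b ≥ 1 and let E ⊆ ⋃_{n≥1} B_n^{a,b} be an identity block. If N > 1 is an integer and 1 ≤ p ≤ r < ∞ are such that τ_{r,N}(E) ≤ N^{1/p − 1/r}, then for every 1 ≤ s < p one has sup_n τ_{s,n}(E) < ∞ (that is, E has block type s). -/
open scoped BigOperators ENNReal

noncomputable section

namespace AsymSeminorms

variable {𝕜 : Type*} [RCLike 𝕜]

/-- A pair of seminorms on `𝕜^n`, used to encode a (finite) basic sequence together with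
the seminorm induced by an operator. -/
abbrev SNPair (𝕜 : Type*) [RCLike 𝕜] (n : ℕ) : Type _ :=
  Seminorm 𝕜 (Fin n → 𝕜) × Seminorm 𝕜 (Fin n → 𝕜)

/-- Truncation of a vector in `𝕜^n` to its first `m` coordinates (the rest set to `0`);
this encodes `∑_{i=1}^m a_i e_i`. -/
def trunc {n : ℕ} (m : ℕ) (a : Fin n → 𝕜) : Fin n → 𝕜 :=
  fun i => if (i : ℕ) < m then a i else 0

/-- Membership in the set `B_n^{a,b}` (here the constants are called `ca`, `cb`):
`r = P.1` is a norm with `r(e_i) = 1`, both seminorms satisfy the `b`-basis inequality for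
truncations, and `ρ = P.2` satisfies `ρ ≤ a·r`. -/
structure MemB (ca cb : ℝ) {n : ℕ} (P : SNPair 𝕜 n) : Prop where
  eq_zero_of : ∀ x : Fin n → 𝕜, P.1 x = 0 → x = 0
  single_eq_one : ∀ i : Fin n, P.1 (Pi.single i 1) = 1
  trunc_fst : ∀ m : ℕ, m ≤ n → ∀ a : Fin n → 𝕜, P.1 (trunc m a) ≤ cb * P.1 a
  trunc_snd : ∀ m : ℕ, m ≤ n → ∀ a : Fin n → 𝕜, P.2 (trunc m a) ≤ cb * P.2 a
  snd_le : ∀ x : Fin n → 𝕜, P.2 x ≤ ca * P.1 x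

/-- The metric `d_n` on `B_n^{a,b}`: the supremum, over coefficient vectors in the unit ball
of `ℓ_∞^n`, of the maximal deviation of the two seminorms. -/
def dB {n : ℕ} (P Q : SNPair 𝕜 n) : ℝ :=
  sSup {x : ℝ | ∃ a : Fin n → 𝕜, (∀ i, ‖a i‖ ≤ 1) ∧
      x = max |P.1 a - Q.1 a| |P.2 a - Q.2 a|}

/-- A family `E`, with `E n` a set of pairs of seminorms on `𝕜^n`; this encodes a subset of
`⋃_{n≥1} B_n^{a,b}`. -/
abbrev Fam (𝕜 : Type*) [RCLike 𝕜] : Type _ := ∀ n : ℕ, Set (SNPair 𝕜 n)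

/-- `E ⊆ ⋃_n B_n^{a,b}`. -/
def SubB (ca cb : ℝ) (E : Fam 𝕜) : Prop := ∀ n, ∀ P ∈ E n, MemB ca cb P

/-- `E` is closed: each `E ∩ B_n^{a,b}` is closed in `B_n^{a,b}` for the metric `d_n`. -/
def ClosedFam (ca cb : ℝ) (E : Fam 𝕜) : Prop :=
  ∀ n, ∀ P : SNPair 𝕜 n, MemB ca cb P →
    (∀ ε : ℝ, 0 < ε → ∃ Q ∈ E n, dB P Q < ε) → P ∈ E n

/-- The `j`-th block piece: the vector `∑_{k_j < i ≤ k_{j+1}} a_i e_i` (with `0`-based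
indexing of the cut points `k`). -/
def piece {n m : ℕ} (a : Fin n → 𝕜) (k : Fin (m + 1) → ℕ) (j : Fin m) : Fin n → 𝕜 :=
  fun i => if k j.castSucc ≤ (i : ℕ) ∧ (i : ℕ) < k j.succ then a i else 0

/-- `(s,σ) = Q` is a block of `(r,ρ) = P`. -/
def IsBlockOf {n m : ℕ} (P : SNPair 𝕜 n) (Q : SNPair 𝕜 m) : Prop :=
  ∃ (a : Fin n → 𝕜) (k : Fin (m + 1) → ℕ),
    k 0 = 0 ∧ StrictMono k ∧ k (Fin.last m) ≤ n ∧
    (∀ j : Fin m, P.1 (piece a k j) = 1) ∧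
    (∀ b : Fin m → 𝕜, Q.1 b = P.1 (∑ j : Fin m, b j • piece a k j)) ∧
    (∀ b : Fin m → 𝕜, Q.2 b = P.2 (∑ j : Fin m, b j • piece a k j))

/-- `E` contains all blocks of its members (that lie in the corresponding `B_m^{a,b}`). -/
def BlockClosedFam (ca cb : ℝ) (E : Fam 𝕜) : Prop :=
  ∀ n m : ℕ, ∀ P ∈ E n, ∀ Q : SNPair 𝕜 m, MemB ca cb Q → IsBlockOf P Q → Q ∈ E m

/-- `E ⊆ ⋃_n B_n^{a,b}` is stable: closed and block closed. -/
def StableFam (ca cb : ℝ) (E : Fam 𝕜) : Prop :=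
  SubB ca cb E ∧ ClosedFam ca cb E ∧ BlockClosedFam ca cb E

/-- `E` is an identity block: stable and `r = ρ` for each member. -/
def IdentityBlockFam (ca cb : ℝ) (E : Fam 𝕜) : Prop :=
  StableFam ca cb E ∧ ∀ n, ∀ P ∈ E n, P.1 = P.2

/-- The `ℓ_p^n` norm of a coefficient vector, `1 ≤ p ≤ ∞`. -/
def lpnorm (p : ℝ≥0∞) {n : ℕ} (a : Fin n → 𝕜) : ℝ :=
  if p = ∞ then ⨆ i, ‖a i‖ else (∑ i, ‖a i‖ ^ p.toReal) ^ (1 / p.toReal)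

/-- The sign `±1 ∈ 𝕜` associated to a Boolean. -/
def sgn (b : Bool) : 𝕜 := if b then 1 else -1

/-- The `L_p` norm of a real function of `n` independent Rademacher variables, i.e. of a
function on `{±1}^n` with the uniform probability measure. -/
def radLp (p : ℝ≥0∞) {n : ℕ} (F : (Fin n → Bool) → ℝ) : ℝ :=
  if p = ∞ then ⨆ ε : Fin n → Bool, |F ε|
  else ((∑ ε : Fin n → Bool, |F ε| ^ p.toReal) / 2 ^ n) ^ (1 / p.toReal)

/-- `α_{p,n}(E)`: the infimum of the constants `T > 0` such that
`ρ(∑ a_i e_i) ≤ T ‖(a_i)‖_{ℓ_p^n}` for all `(r,ρ) ∈ E ∩ B_n^{a,b}`. -/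
def alphaC (p : ℝ≥0∞) (E : Fam 𝕜) (n : ℕ) : ℝ :=
  sInf {T : ℝ | 0 < T ∧ ∀ P ∈ E n, ∀ a : Fin n → 𝕜, P.2 a ≤ T * lpnorm p a}

/-- `β_{q,n}(E)`: the infimum of the constants `C > 0` such that
`C r(∑ a_i e_i) ≥ ‖(a_i ρ(e_i))‖_{ℓ_q^n}` for all `(r,ρ) ∈ E ∩ B_n^{a,b}`. -/
def betaC (q : ℝ≥0∞) (E : Fam 𝕜) (n : ℕ) : ℝ :=
  sInf {C : ℝ | 0 < C ∧ ∀ P ∈ E n, ∀ a : Fin n → 𝕜,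
    lpnorm q (fun i => a i * ((P.2 (Pi.single i 1) : ℝ) : 𝕜)) ≤ C * P.1 a}

/-- `τ_{p,n}(E)`: the infimum of the constants `T > 0` such that
`‖ρ(∑ ε_i a_i e_i)‖_{L_p} ≤ T ‖(a_i)‖_{ℓ_p^n}` for all `(r,ρ) ∈ E ∩ B_n^{a,b}`. -/
def tauC (p : ℝ≥0∞) (E : Fam 𝕜) (n : ℕ) : ℝ :=
  sInf {T : ℝ | 0 < T ∧ ∀ P ∈ E n, ∀ a : Fin n → 𝕜,
    radLp p (fun ε => P.2 (fun i => sgn (ε i) * a i)) ≤ T * lpnorm p a}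

/-- `γ_{q,n}(E)`: the infimum of the constants `C > 0` such that
`C ‖r(∑ ε_i a_i e_i)‖_{L_q} ≥ ‖(a_i ρ(e_i))‖_{ℓ_q^n}` for all `(r,ρ) ∈ E ∩ B_n^{a,b}`. -/
def gammaC (q : ℝ≥0∞) (E : Fam 𝕜) (n : ℕ) : ℝ :=
  sInf {C : ℝ | 0 < C ∧ ∀ P ∈ E n, ∀ a : Fin n → 𝕜,
    lpnorm q (fun i => a i * ((P.2 (Pi.single i 1) : ℝ) : 𝕜)) ≤
      C * radLp q (fun ε => P.1 (fun i => sgn (ε i) * a i))}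

/-- `θ_n(E)`: the infimum of the constants `T > 0` such that
`ρ((1/n) ∑ a_i e_i) ≤ T ‖(a_i)‖_{ℓ_∞^n}` for all `(r,ρ) ∈ E ∩ B_n^{a,b}`. -/
def thetaC (E : Fam 𝕜) (n : ℕ) : ℝ :=
  sInf {T : ℝ | 0 < T ∧ ∀ P ∈ E n, ∀ a : Fin n → 𝕜,
    P.2 ((n : 𝕜)⁻¹ • a) ≤ T * lpnorm ∞ a}

/-- `Θ_n(E)`: the infimum of the constants `T > 0` such that
`‖ρ((1/n) ∑ ε_i a_i e_i)‖_{L_1} ≤ T ‖(a_i)‖_{ℓ_∞^n}` for all `(r,ρ) ∈ E ∩ B_n^{a,b}`. -/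
def bigThetaC (E : Fam 𝕜) (n : ℕ) : ℝ :=
  sInf {T : ℝ | 0 < T ∧ ∀ P ∈ E n, ∀ a : Fin n → 𝕜,
    radLp 1 (fun ε => P.2 ((n : 𝕜)⁻¹ • fun i => sgn (ε i) * a i)) ≤ T * lpnorm ∞ a}

/-- `υ_n(E)`: the infimum of the constants `C > 0` such that
`C r(∑ a_i e_i) ≥ min_i |a_i| ρ(e_i)` for all `(r,ρ) ∈ E ∩ B_n^{a,b}`. -/
def upsC (E : Fam 𝕜) (n : ℕ) : ℝ :=
  sInf {C : ℝ | 0 < C ∧ ∀ P ∈ E n, ∀ a : Fin n → 𝕜,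
    (⨅ i, ‖a i‖ * P.2 (Pi.single i 1)) ≤ C * P.1 a}

/-- `Υ_n(E)`: the infimum of the constants `C > 0` such that
`C ‖r(∑ ε_i a_i e_i)‖_{L_1} ≥ min_i |a_i| ρ(e_i)` for all `(r,ρ) ∈ E ∩ B_n^{a,b}`. -/
def bigUpsC (E : Fam 𝕜) (n : ℕ) : ℝ :=
  sInf {C : ℝ | 0 < C ∧ ∀ P ∈ E n, ∀ a : Fin n → 𝕜,
    (⨅ i, ‖a i‖ * P.2 (Pi.single i 1)) ≤
      C * radLp 1 (fun ε => P.1 (fun i => sgn (ε i) * a i))}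

end AsymSeminorms

namespace AsymSeminorms

section Helpers

variable {𝕜 : Type*} [RCLike 𝕜]

lemma norm_sgn (b : Bool) : ‖(sgn b : 𝕜)‖ = 1 := by
  cases b <;> simp [sgn]

lemma sgn_beq (b c : Bool) : (sgn (b == c) : 𝕜) = sgn b * sgn c := by
  cases b <;> cases c <;> simp [sgn]

lemma sgn_ne_zero (b : Bool) : (sgn b : 𝕜) ≠ 0 := by
  cases b <;> simp [sgn]

/-- The intervals given by increasing cut points are disjoint. -/
lemma interval_unique {m : ℕ} {k : Fin (m + 1) → ℕ} (hk : StrictMono k) {i : ℕ} {j l : Fin m}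
    (hj : k j.castSucc ≤ i ∧ i < k j.succ) (hl : k l.castSucc ≤ i ∧ i < k l.succ) : l = j := by
  by_contra hne
  rcases lt_or_gt_of_ne hne with h | h
  · have : k l.succ ≤ k j.castSucc := hk.monotone (by rw [Fin.le_def]; simpa using h)
    omega
  · have : k j.succ ≤ k l.castSucc := hk.monotone (by rw [Fin.le_def]; simpa using h)
    omega

/-- A combination of block pieces, evaluated in the `j`-th interval. -/
lemma sum_smul_piece_apply {n m : ℕ} (a : Fin n → 𝕜) {k : Fin (m + 1) → ℕ} (hk : StrictMono k)
    (b : Fin m → 𝕜) {i : Fin n} {j : Fin m} (h : k j.castSucc ≤ (i : ℕ) ∧ (i : ℕ) < k j.succ) :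
    (∑ l, b l • piece a k l) i = b j * a i := by
  rw [Finset.sum_apply, Finset.sum_eq_single j]
  · simp [piece, h]
  · intro l _ hl
    simp only [piece, Pi.smul_apply, smul_eq_mul]
    rw [if_neg (fun h' => hl (interval_unique hk h h')), mul_zero]
  · simp

lemma piece_sum_smul_piece {n m : ℕ} (a : Fin n → 𝕜) {k : Fin (m + 1) → ℕ} (hk : StrictMono k)
    (b : Fin m → 𝕜) (j : Fin m) :
    piece (∑ l, b l • piece a k l) k j = b j • piece a k j := by
  funext i
  by_cases h : k j.castSucc ≤ (i : ℕ) ∧ (i : ℕ) < k j.succ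
  · simp only [piece, h, and_self, if_true, Pi.smul_apply, smul_eq_mul]
    exact sum_smul_piece_apply a hk b h
  · simp [piece, h]

lemma trunc_sum_smul_piece {n m : ℕ} (a : Fin n → 𝕜) {k : Fin (m + 1) → ℕ} (hk : StrictMono k)
    (b : Fin m → 𝕜) (l : Fin (m + 1)) :
    trunc (k l) (∑ j, b j • piece a k j) = ∑ j, trunc (l : ℕ) b j • piece a k j := by
  funext i
  simp only [trunc, Finset.sum_apply, Pi.smul_apply, smul_eq_mul]
  by_cases h : (i : ℕ) < k l
  · rw [if_pos h]
    refine Finset.sum_congr rfl fun j _ => ?_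
    by_cases hj : (j : ℕ) < l
    · rw [if_pos hj]
    · have : k l ≤ k j.castSucc := hk.monotone (by rw [Fin.le_def]; simpa using hj)
      simp only [piece]
      rw [if_neg (by omega), mul_zero, mul_zero]
  · rw [if_neg h, eq_comm]
    refine Finset.sum_eq_zero fun j _ => ?_
    by_cases hj : (j : ℕ) < l
    · have : k j.succ ≤ k l := hk.monotone (by rw [Fin.le_def]; simpa using hj)
      simp only [piece]
      rw [if_pos hj, if_neg (by omega), mul_zero]
    · rw [if_neg hj, zero_mul]

/-- The pair of seminorms spanned by normalized block pieces. -/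
def blockPair {n m : ℕ} (P : SNPair 𝕜 n) (a : Fin n → 𝕜) (k : Fin (m + 1) → ℕ) : SNPair 𝕜 m :=
  (P.1.comp (Fintype.linearCombination 𝕜 (piece a k)),
    P.2.comp (Fintype.linearCombination 𝕜 (piece a k)))

lemma memB_blockPair {ca cb : ℝ} {n m : ℕ} {P : SNPair 𝕜 n} (hP : MemB ca cb P)
    {a : Fin n → 𝕜} {k : Fin (m + 1) → ℕ} (hk : StrictMono k) (hkn : k (Fin.last m) ≤ n)
    (ha : ∀ j, P.1 (piece a k j) = 1) : MemB ca cb (blockPair P a k) where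
  eq_zero_of x hx := by
    have h := hP.eq_zero_of _ hx
    rw [Fintype.linearCombination_apply] at h
    funext j
    have h2 := piece_sum_smul_piece a hk x j
    rw [h] at h2
    have h3 : x j • piece a k j = 0 := by
      rw [← h2]; funext i; simp [piece]
    rcases smul_eq_zero.1 h3 with h4 | h4
    · exact h4
    · have := ha j
      rw [h4, map_zero] at this
      norm_num at this
  single_eq_one j := by
    simp [blockPair, ha]
  trunc_fst l hl b := by
    have h := trunc_sum_smul_piece a hk b ⟨l, by omega⟩
    simp only [blockPair, Seminorm.comp_apply, Fintype.linearCombination_apply]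
    rw [← h]
    exact hP.trunc_fst _ ((hk.monotone (Fin.le_last _)).trans hkn) _
  trunc_snd l hl b := by
    have h := trunc_sum_smul_piece a hk b ⟨l, by omega⟩
    simp only [blockPair, Seminorm.comp_apply, Fintype.linearCombination_apply]
    rw [← h]
    exact hP.trunc_snd _ ((hk.monotone (Fin.le_last _)).trans hkn) _
  snd_le x := hP.snd_le _

lemma blockPair_mem {ca cb : ℝ} {E : Fam 𝕜} (hE : StableFam ca cb E) {n m : ℕ} {P : SNPair 𝕜 n}
    (hP : P ∈ E n) {a : Fin n → 𝕜} {k : Fin (m + 1) → ℕ} (hk0 : k 0 = 0) (hk : StrictMono k)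
    (hkn : k (Fin.last m) ≤ n) (ha : ∀ j, P.1 (piece a k j) = 1) : blockPair P a k ∈ E m :=
  hE.2.2 n m P hP _ (memB_blockPair (hE.1 n P hP) hk hkn ha)
    ⟨a, k, hk0, hk, hkn, ha, fun b => by simp [blockPair, Fintype.linearCombination_apply],
      fun b => by simp [blockPair, Fintype.linearCombination_apply]⟩

lemma sum_sgn_smul_piece_le {ca cb : ℝ} {E : Fam 𝕜} (hE : IdentityBlockFam ca cb E)
    {N : ℕ} {r K : ℝ}
    (hK : ∀ Q ∈ E N, ∀ b : Fin N → 𝕜,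
      ∑ δ : Fin N → Bool, Q.2 (fun j => sgn (δ j) * b j) ^ r ≤ 2 ^ N * (K * ∑ j, ‖b j‖ ^ r))
    {n : ℕ} {P : SNPair 𝕜 n} (hP : P ∈ E n) {c : Fin n → 𝕜} {k : Fin (N + 1) → ℕ}
    (hk0 : k 0 = 0) (hk : StrictMono k) (hkn : k (Fin.last N) ≤ n) (hc : ∀ j, piece c k j ≠ 0) :
    ∑ δ : Fin N → Bool, P.2 (∑ j, (sgn (δ j) : 𝕜) • piece c k j) ^ r ≤
      2 ^ N * (K * ∑ j, P.2 (piece c k j) ^ r) := by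
  have hpos : ∀ j, P.2 (piece c k j) ≠ 0 := fun j h => by
    rw [← hE.2 n P hP] at h
    exact hc j ((hE.1.1 n P hP).eq_zero_of _ h)
  set w : Fin N → 𝕜 := fun j => ((P.2 (piece c k j) : ℝ) : 𝕜) with hw
  set a : Fin n → 𝕜 := ∑ j, (w j)⁻¹ • piece c k j with ha
  have hw0 : ∀ j, w j ≠ 0 := fun j => by simpa [hw] using hpos j
  have hnw : ∀ j, ‖w j‖ = P.2 (piece c k j) := fun j => by
    simp [hw, abs_of_nonneg (apply_nonneg P.2 _)]
  have hpa : ∀ j, piece a k j = (w j)⁻¹ • piece c k j := piece_sum_smul_piece c hk _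
  have h1 : ∀ j, P.1 (piece a k j) = 1 := fun j => by
    rw [hpa, hE.2 n P hP, map_smul_eq_mul, norm_inv, hnw, inv_mul_cancel₀ (hpos j)]
  have h := hK _ (blockPair_mem hE.1 hP hk0 hk hkn h1) w
  simp only [hnw] at h
  refine le_of_eq_of_le (Finset.sum_congr rfl fun δ _ => ?_) h
  simp only [blockPair, Seminorm.comp_apply, Fintype.linearCombination_apply, hpa, smul_smul,
    mul_assoc, mul_inv_cancel₀ (hw0 _), mul_one]

/-- Cut points splitting a set of `N * M` indices into `N` successive groups of `M` indices. -/
lemma exists_cuts {n N M : ℕ} (hM : 0 < M) (A : Finset (Fin n)) (hA : A.card = N * M) :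
    ∃ k : Fin (N + 1) → ℕ, k 0 = 0 ∧ StrictMono k ∧ k (Fin.last N) ≤ n ∧
      (∀ j : Fin N,
        (A.filter fun i : Fin n => k j.castSucc ≤ (i : ℕ) ∧ (i : ℕ) < k j.succ).card = M) ∧
      ∀ i ∈ A, ∃ j : Fin N, k j.castSucc ≤ (i : ℕ) ∧ (i : ℕ) < k j.succ := by
  set c : ℕ → ℕ := fun t => (A.filter fun i : Fin n => (i : ℕ) < t).card with hc
  have hc0 : c 0 = 0 := by simp [hc]
  have hcn : c n = N * M := by
    rw [← hA, hc]
    simp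
  have hmono : Monotone c := fun s t hst => Finset.card_le_card fun i => by
    simp only [Finset.mem_filter]
    rintro ⟨h₁, h₂⟩
    exact ⟨h₁, by omega⟩
  have hstep : ∀ t, c (t + 1) ≤ c t + 1 := fun t => by
    have hsub : (A.filter fun i : Fin n => (i : ℕ) < t + 1) ⊆
        (A.filter fun i : Fin n => (i : ℕ) < t) ∪ (A.filter fun i : Fin n => (i : ℕ) = t) :=
      fun i => by
        simp only [Finset.mem_filter, Finset.mem_union]
        rintro ⟨h₁, h₂⟩
        by_cases h : (i : ℕ) = t
        · exact Or.inr ⟨h₁, h⟩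
        · exact Or.inl ⟨h₁, by omega⟩
    refine (Finset.card_le_card hsub).trans ((Finset.card_union_le _ _).trans ?_)
    refine Nat.add_le_add_left (Finset.card_le_one.2 fun i hi l hl => ?_) _
    simp only [Finset.mem_filter] at hi hl
    exact Fin.ext (by omega)
  have hivt : ∀ s v, v ≤ c s → ∃ t ≤ s, c t = v := by
    intro s
    induction s with
    | zero => exact fun v hv => ⟨0, le_rfl, by omega⟩
    | succ s ih =>
      intro v hv
      rcases Nat.lt_or_ge (c s) v with h | h
      · exact ⟨s + 1, le_rfl, by have := hstep s; omega⟩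
      · obtain ⟨t, ht, h⟩ := ih v h
        exact ⟨t, by omega, h⟩
  have hex : ∀ j : Fin (N + 1), ∃ t ≤ n, c t = j * M ∧ (j = 0 → t = 0) := fun j => by
    by_cases h : j = 0
    · exact ⟨0, by omega, by simp [h, hc0], fun _ => rfl⟩
    · obtain ⟨t, ht, h'⟩ := hivt n (j * M) (by rw [hcn]; exact Nat.mul_le_mul_right _ (by omega))
      exact ⟨t, ht, h', fun h'' => absurd h'' h⟩
  choose k hkn hck hk0 using hex
  have hk : StrictMono k := fun i j hij => by
    by_contra hcon
    have := hmono (not_lt.1 hcon)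
    rw [hck, hck] at this
    have h' := Nat.le_of_mul_le_mul_right this hM
    exact absurd hij (not_lt.2 h')
  refine ⟨k, hk0 0 rfl, hk, hkn _, fun j => ?_, fun i hi => ?_⟩
  · have hsplit : (A.filter fun i : Fin n => (i : ℕ) < k j.castSucc).card +
        (A.filter fun i : Fin n => k j.castSucc ≤ (i : ℕ) ∧ (i : ℕ) < k j.succ).card =
        (A.filter fun i : Fin n => (i : ℕ) < k j.succ).card := by
      rw [← Finset.card_union_of_disjoint]
      · congr 1
        ext i
        have := hk (Fin.castSucc_lt_succ (i := j))
        simp only [Finset.mem_union, Finset.mem_filter]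
        grind
      · rw [Finset.disjoint_left]
        intro i
        simp only [Finset.mem_filter]
        grind
    have h₁ := hck j.castSucc
    have h₂ := hck j.succ
    simp only [hc, Fin.val_castSucc, Fin.val_succ, add_mul, one_mul] at h₁ h₂
    omega
  · have hlast : (i : ℕ) < k (Fin.last N) := by
      by_contra hcon
      have hss : (A.filter fun i : Fin n => (i : ℕ) < k (Fin.last N)) ⊂ A :=
        Finset.filter_ssubset.2 ⟨i, hi, hcon⟩
      have := Finset.card_lt_card hss
      have h₁ := hck (Fin.last N)
      simp only [hc, Fin.val_last] at h₁
      omega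
    by_contra! hcon
    have : ∀ j : Fin (N + 1), k j ≤ i := by
      intro j
      induction j using Fin.induction with
      | zero => rw [hk0 0 rfl]; exact Nat.zero_le _
      | succ j ih => exact hcon j ih
    exact absurd (this (Fin.last N)) (not_le.2 hlast)

/-- The restriction of a coefficient vector to a set of indices. -/
def restr {n : ℕ} (A : Finset (Fin n)) (a : Fin n → 𝕜) : Fin n → 𝕜 :=
  fun i => if i ∈ A then a i else 0

lemma piece_restr {n m : ℕ} (A : Finset (Fin n)) (a : Fin n → 𝕜) (k : Fin (m + 1) → ℕ)
    (j : Fin m) : piece (restr A a) k j =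
      restr (A.filter fun i : Fin n => k j.castSucc ≤ (i : ℕ) ∧ (i : ℕ) < k j.succ) a := by
  funext i
  simp only [piece, restr, Finset.mem_filter]
  grind

lemma sum_restr_rpow_le {ca cb : ℝ} {E : Fam 𝕜} (hE : IdentityBlockFam ca cb E)
    {N : ℕ} (hN : 0 < N) {r K : ℝ} (hK0 : 0 ≤ K)
    (hK : ∀ Q ∈ E N, ∀ b : Fin N → 𝕜,
      ∑ δ : Fin N → Bool, Q.2 (fun j => sgn (δ j) * b j) ^ r ≤ 2 ^ N * (K * ∑ j, ‖b j‖ ^ r))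
    {n : ℕ} {P : SNPair 𝕜 n} (hP : P ∈ E n) (a : Fin n → 𝕜) (v : ℕ) :
    ∀ A : Finset (Fin n), A.card = N ^ v → (∀ i ∈ A, a i ≠ 0) →
      ∑ ε : Fin n → Bool, P.2 (restr A fun i => sgn (ε i) * a i) ^ r ≤
        2 ^ n * (K ^ v * ∑ i ∈ A, ‖a i‖ ^ r) := by
  induction v with
  | zero =>
    intro A hA _
    obtain ⟨i, rfl⟩ := Finset.card_eq_one.1 hA
    have h : ∀ ε : Fin n → Bool, P.2 (restr {i} fun i => sgn (ε i) * a i) = ‖a i‖ := fun ε => by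
      have : (restr {i} fun i => sgn (ε i) * a i) =
          (sgn (ε i) * a i) • (Pi.single i (1 : 𝕜) : Fin n → 𝕜) := by
        funext l
        by_cases h : l = i
        · subst h; simp [restr]
        · simp [restr, h]
      rw [this, map_smul_eq_mul, norm_mul, norm_sgn, ← hE.2 n P hP,
        (hE.1.1 n P hP).single_eq_one, one_mul, mul_one]
    simp [h]
  | succ v ih =>
    intro A hA ha
    obtain ⟨k, hk0, hk, hkn, hcard, hcov⟩ :=
      exists_cuts (pow_pos hN v) A (by rw [hA, pow_succ, mul_comm])
    have : NeZero N := ⟨hN.ne'⟩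
    choose! g hg using hcov
    set B : Fin N → Finset (Fin n) := fun j =>
      A.filter fun i : Fin n => k j.castSucc ≤ (i : ℕ) ∧ (i : ℕ) < k j.succ with hB
    have hBg : ∀ j, B j = A.filter fun i => g i = j := fun j => by
      refine Finset.filter_congr fun i hi => ⟨fun h => interval_unique hk h (hg i hi), ?_⟩
      rintro rfl
      exact hg i hi
    have hflip : ∀ (δ : Fin N → Bool) (ε : Fin n → Bool),
        ∑ j, (sgn (δ j) : 𝕜) • piece (restr A fun i => sgn (ε i) * a i) k j =
          restr A fun i => sgn (ε i == δ (g i)) * a i := fun δ ε => by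
      funext i
      by_cases hi : i ∈ A
      · rw [sum_smul_piece_apply _ hk _ (hg i hi)]
        simp only [restr, hi, if_true, sgn_beq]
        ring
      · simp [restr, hi, piece]
    have hne : ∀ (ε : Fin n → Bool) (j : Fin N),
        piece (restr A fun i => sgn (ε i) * a i) k j ≠ 0 := fun ε j h => by
      rw [piece_restr] at h
      obtain ⟨i, hi⟩ := Finset.card_pos.1 (by rw [hcard j]; exact pow_pos hN v)
      have h' := congrFun h i
      simp only [restr, hi, if_true, Pi.zero_apply, mul_eq_zero, sgn_ne_zero, false_or] at h'
      exact ha i (Finset.mem_filter.1 hi).1 h'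
    have hinv : ∀ δ : Fin N → Bool, Function.Involutive
        (fun (ε : Fin n → Bool) i => (ε i == δ (g i))) := fun δ ε => by
      funext i
      change ((ε i == δ (g i)) == δ (g i)) = ε i
      cases ε i <;> cases δ (g i) <;> rfl
    set F : (Fin n → Bool) → ℝ := fun ε => P.2 (restr A fun i => sgn (ε i) * a i) ^ r with hF
    have key : (2 : ℝ) ^ N * ∑ ε, F ε ≤
        2 ^ N * (2 ^ n * (K ^ (v + 1) * ∑ i ∈ A, ‖a i‖ ^ r)) := by
      calc (2 : ℝ) ^ N * ∑ ε, F ε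
          = ∑ _δ : Fin N → Bool, ∑ ε, F ε := by simp
        _ = ∑ δ : Fin N → Bool, ∑ ε : Fin n → Bool, F fun i => (ε i == δ (g i)) :=
          Finset.sum_congr rfl fun δ _ => (Equiv.sum_comp (hinv δ).toPerm F).symm
        _ = ∑ ε : Fin n → Bool, ∑ δ : Fin N → Bool,
            P.2 (∑ j, (sgn (δ j) : 𝕜) • piece (restr A fun i => sgn (ε i) * a i) k j) ^ r := by
          rw [Finset.sum_comm]
          simp only [hflip, hF]
        _ ≤ ∑ ε : Fin n → Bool, 2 ^ N * (K * ∑ j,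
            P.2 (piece (restr A fun i => sgn (ε i) * a i) k j) ^ r) :=
          Finset.sum_le_sum fun ε _ => sum_sgn_smul_piece_le hE hK hP hk0 hk hkn (hne ε)
        _ = 2 ^ N * (K * ∑ j, ∑ ε : Fin n → Bool,
            P.2 (restr (B j) fun i => sgn (ε i) * a i) ^ r) := by
          rw [Finset.sum_comm (s := (Finset.univ : Finset (Fin N))), Finset.mul_sum,
            Finset.mul_sum]
          simp only [piece_restr, hB]
        _ ≤ 2 ^ N * (K * ∑ j, 2 ^ n * (K ^ v * ∑ i ∈ B j, ‖a i‖ ^ r)) := by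
          gcongr with j _
          exact ih (B j) (hcard j) fun i hi => ha i (Finset.mem_filter.1 hi).1
        _ = 2 ^ N * (2 ^ n * (K ^ (v + 1) * ∑ i ∈ A, ‖a i‖ ^ r)) := by
          rw [← Finset.mul_sum, ← Finset.mul_sum, ← Finset.sum_fiberwise A g]
          simp only [hBg]
          ring
    exact le_of_mul_le_mul_left key (by positivity)

lemma radLp_ofReal {r : ℝ} (hr : 0 ≤ r) {n : ℕ} (F : (Fin n → Bool) → ℝ) :
    radLp (ENNReal.ofReal r) F = ((∑ ε, |F ε| ^ r) / 2 ^ n) ^ (1 / r) := by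
  simp [radLp, ENNReal.toReal_ofReal hr]

lemma lpnorm_ofReal {r : ℝ} (hr : 0 ≤ r) {n : ℕ} (a : Fin n → 𝕜) :
    lpnorm (ENNReal.ofReal r) a = (∑ i, ‖a i‖ ^ r) ^ (1 / r) := by
  simp [lpnorm, ENNReal.toReal_ofReal hr]

lemma lpnorm_nonneg {r : ℝ} (hr : 0 ≤ r) {n : ℕ} (a : Fin n → 𝕜) :
    0 ≤ lpnorm (ENNReal.ofReal r) a := by
  rw [lpnorm_ofReal hr]
  positivity

lemma norm_le_lpnorm {r : ℝ} (hr : 0 < r) {n : ℕ} (a : Fin n → 𝕜) (i : Fin n) :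
    ‖a i‖ ≤ lpnorm (ENNReal.ofReal r) a := by
  rw [lpnorm_ofReal hr.le]
  calc ‖a i‖ = (‖a i‖ ^ r) ^ (1 / r) := by
        rw [← Real.rpow_mul (norm_nonneg _), mul_one_div_cancel hr.ne', Real.rpow_one]
    _ ≤ _ := Real.rpow_le_rpow (by positivity)
        (Finset.single_le_sum (f := fun i => ‖a i‖ ^ r) (fun _ _ => by positivity)
          (Finset.mem_univ i)) (by positivity)

lemma lpnorm_rpow {r : ℝ} (hr : 0 < r) {n : ℕ} (a : Fin n → 𝕜) :
    lpnorm (ENNReal.ofReal r) a ^ r = ∑ i, ‖a i‖ ^ r := by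
  rw [lpnorm_ofReal hr.le, ← Real.rpow_mul (by positivity), one_div_mul_cancel hr.ne',
    Real.rpow_one]

lemma radLp_rpow {r : ℝ} (hr : 0 < r) {n : ℕ} (F : (Fin n → Bool) → ℝ) :
    radLp (ENNReal.ofReal r) F ^ r = (∑ ε, |F ε| ^ r) / 2 ^ n := by
  rw [radLp_ofReal hr.le, ← Real.rpow_mul (by positivity), one_div_mul_cancel hr.ne',
    Real.rpow_one]

lemma radLp_nonneg {r : ℝ} (hr : 0 ≤ r) {n : ℕ} (F : (Fin n → Bool) → ℝ) :
    0 ≤ radLp (ENNReal.ofReal r) F := by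
  rw [radLp_ofReal hr]
  positivity

lemma radLp_mono {r : ℝ} (hr : 0 ≤ r) {n : ℕ} {F G : (Fin n → Bool) → ℝ}
    (hF : ∀ ε, 0 ≤ F ε) (hFG : ∀ ε, F ε ≤ G ε) :
    radLp (ENNReal.ofReal r) F ≤ radLp (ENNReal.ofReal r) G := by
  rw [radLp_ofReal hr, radLp_ofReal hr]
  gcongr with ε
  · exact hF ε
  · exact hFG ε

lemma radLp_const {r : ℝ} (hr : 0 < r) (n : ℕ) {M : ℝ} (hM : 0 ≤ M) :
    radLp (ENNReal.ofReal r) (fun _ : Fin n → Bool => M) = M := by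
  rw [radLp_ofReal hr.le]
  simp only [Finset.sum_const, Finset.card_univ, Fintype.card_pi, Fintype.card_bool,
    Finset.prod_const, Fintype.card_fin, nsmul_eq_mul, Nat.cast_pow, Nat.cast_ofNat,
    abs_of_nonneg hM]
  rw [mul_div_cancel_left₀ _ (by positivity), ← Real.rpow_mul hM, mul_one_div_cancel hr.ne',
    Real.rpow_one]

lemma radLp_add_le {r : ℝ} (hr : 1 ≤ r) {n : ℕ} {F G : (Fin n → Bool) → ℝ}
    (hF : ∀ ε, 0 ≤ F ε) (hG : ∀ ε, 0 ≤ G ε) :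
    radLp (ENNReal.ofReal r) (fun ε => F ε + G ε) ≤
      radLp (ENNReal.ofReal r) F + radLp (ENNReal.ofReal r) G := by
  have hr0 : 0 ≤ r := by linarith
  simp only [radLp_ofReal hr0, abs_of_nonneg (hF _), abs_of_nonneg (hG _),
    abs_of_nonneg (add_nonneg (hF _) (hG _))]
  rw [Real.div_rpow (Finset.sum_nonneg fun ε _ => Real.rpow_nonneg (add_nonneg (hF ε) (hG ε)) _)
      (by positivity),
    Real.div_rpow (Finset.sum_nonneg fun ε _ => Real.rpow_nonneg (hF ε) _) (by positivity),
    Real.div_rpow (Finset.sum_nonneg fun ε _ => Real.rpow_nonneg (hG ε) _) (by positivity),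
    ← add_div]
  gcongr
  exact Real.Lp_add_le_of_nonneg _ hr (fun ε _ => hF ε) fun ε _ => hG ε

/-- Monotonicity of `L_p` norms on a probability space. -/
lemma radLp_le_radLp {s r : ℝ} (hs : 0 < s) (hsr : s ≤ r) {n : ℕ} (F : (Fin n → Bool) → ℝ) :
    radLp (ENNReal.ofReal s) F ≤ radLp (ENNReal.ofReal r) F := by
  have hr : 0 < r := hs.trans_le hsr
  have h := Real.rpow_arith_mean_le_arith_mean_rpow Finset.univ
    (fun _ : Fin n → Bool => ((2 : ℝ) ^ n)⁻¹) (fun ε => |F ε| ^ s) (fun _ _ => by positivity)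
    (by simp) (fun _ _ => by positivity) (p := r / s) ((one_le_div hs).2 hsr)
  simp only [← Finset.mul_sum, ← Real.rpow_mul (abs_nonneg _), mul_div_cancel₀ _ hs.ne'] at h
  rw [radLp_ofReal hs.le, radLp_ofReal hr.le, div_eq_inv_mul,
    div_eq_inv_mul (∑ ε, |F ε| ^ r)]
  have h' := Real.rpow_le_rpow (by positivity) h (z := 1 / r) (by positivity)
  rw [← Real.rpow_mul (by positivity)] at h'
  convert h' using 2
  field_simp

lemma radLp_const_mul {r : ℝ} (hr : 0 < r) {n : ℕ} {L : ℝ} (hL : 0 ≤ L)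
    (F : (Fin n → Bool) → ℝ) :
    radLp (ENNReal.ofReal r) (fun ε => L * F ε) = L * radLp (ENNReal.ofReal r) F := by
  simp only [radLp_ofReal hr.le, abs_mul, abs_of_nonneg hL, Real.mul_rpow hL (abs_nonneg _)]
  rw [← Finset.mul_sum, mul_div_assoc, Real.mul_rpow (by positivity) (by positivity),
    ← Real.rpow_mul hL, mul_one_div_cancel hr.ne', Real.rpow_one]

/-- The infimum defining `τ_{r,n}(E)` is attained. -/
lemma radLp_le_tauC_mul {ca cb : ℝ} {E : Fam 𝕜} (hE : IdentityBlockFam ca cb E) {r : ℝ}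
    (hr : 1 ≤ r) {n : ℕ} {P : SNPair 𝕜 n} (hP : P ∈ E n) (a : Fin n → 𝕜) :
    radLp (ENNReal.ofReal r) (fun ε => P.2 (fun i => sgn (ε i) * a i)) ≤
      tauC (ENNReal.ofReal r) E n * lpnorm (ENNReal.ofReal r) a := by
  have hr0 : 0 < r := by linarith
  have hne : {T : ℝ | 0 < T ∧ ∀ P ∈ E n, ∀ a : Fin n → 𝕜,
      radLp (ENNReal.ofReal r) (fun ε => P.2 (fun i => sgn (ε i) * a i)) ≤
        T * lpnorm (ENNReal.ofReal r) a}.Nonempty := by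
    refine ⟨n + 1, by positivity, fun P hP a => ?_⟩
    have hL := lpnorm_nonneg hr0.le a
    rw [← radLp_const hr0 n (mul_nonneg (by positivity : (0 : ℝ) ≤ n + 1) hL)]
    refine radLp_mono hr0.le (fun ε => apply_nonneg _ _) fun ε => ?_
    have hsum : (fun i => sgn (ε i) * a i) =
        ∑ i, (sgn (ε i) * a i) • (Pi.single i (1 : 𝕜) : Fin n → 𝕜) :=
      pi_eq_sum_univ' _ |>.trans (by simp)
    calc P.2 (fun i => sgn (ε i) * a i)
        ≤ ∑ i, P.2 ((sgn (ε i) * a i) • (Pi.single i (1 : 𝕜) : Fin n → 𝕜)) := by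
          rw [hsum]
          exact Finset.le_sum_of_subadditive P.2 (map_zero P.2).le (map_add_le_add P.2) _ _
      _ ≤ ∑ _i : Fin n, lpnorm (ENNReal.ofReal r) a := by
          refine Finset.sum_le_sum fun i _ => ?_
          rw [map_smul_eq_mul, norm_mul, norm_sgn, ← hE.2 n P hP,
            (hE.1.1 n P hP).single_eq_one, one_mul, mul_one]
          exact norm_le_lpnorm hr0 a i
      _ ≤ (n + 1) * lpnorm (ENNReal.ofReal r) a := by
          simp only [Finset.sum_const, Finset.card_univ, Fintype.card_fin, nsmul_eq_mul]
          nlinarith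
  rcases (lpnorm_nonneg hr0.le a).eq_or_lt with h0 | hpos
  · obtain ⟨T, -, hT⟩ := hne
    have := hT P hP a
    rwa [← h0, mul_zero] at this ⊢
  · rw [← div_le_iff₀ hpos]
    exact le_csInf hne fun T hT => (div_le_iff₀ hpos).2 (hT.2 P hP a)

end Helpers

section Combinatorics

variable {ι : Type*} [DecidableEq ι] {Ψ : Finset ι → ℝ}

/-- A subadditive set function controlled on sets whose size is a power of `N` is controlled on
all sets. -/
lemma subadditive_le_of_card_lt (h0 : Ψ ∅ ≤ 0)
    (hadd : ∀ A B, Disjoint A B → Ψ (A ∪ B) ≤ Ψ A + Ψ B) {N : ℕ} {x t : ℝ}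
    (hx : 1 < x) (ht : 0 ≤ t) {S : Finset ι}
    (hS : ∀ v, ∀ A ⊆ S, A.card = N ^ v → Ψ A ≤ t * x ^ v) (v : ℕ) :
    ∀ A ⊆ S, A.card < N ^ v → Ψ A ≤ N / (x - 1) * t * x ^ v := by
  have hx' : 0 < x - 1 := by linarith
  have hx0 : 0 < x := by linarith
  induction v with
  | zero =>
    intro A _ hA
    obtain rfl : A = ∅ := by simpa using hA
    exact h0.trans (by positivity)
  | succ v ih =>
    have aux : ∀ q : ℕ, ∀ A ⊆ S, A.card < (q + 1) * N ^ v →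
        Ψ A ≤ q * (t * x ^ v) + N / (x - 1) * t * x ^ v := by
      intro q
      induction q with
      | zero =>
        intro A hAS hA
        simpa using ih A hAS (by simpa using hA)
      | succ q ihq =>
        intro A hAS hA
        rcases Nat.lt_or_ge A.card ((q + 1) * N ^ v) with h | h
        · refine (ihq A hAS h).trans ?_
          have : 0 ≤ t * x ^ v := by positivity
          push_cast
          linarith
        · obtain ⟨B, hBA, hB⟩ := Finset.exists_subset_card_eq (n := N ^ v) (s := A) (by nlinarith)
          have hcard := Finset.card_sdiff_add_card_eq_card hBA
          have h₁ := ihq (A \ B) (Finset.sdiff_subset.trans hAS) (by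
            have : (q + 1 + 1) * N ^ v = (q + 1) * N ^ v + N ^ v := by ring
            omega)
          have h₂ := hS v B (hBA.trans hAS) hB
          have h₃ := hadd (A \ B) B Finset.sdiff_disjoint
          rw [Finset.sdiff_union_of_subset hBA] at h₃
          push_cast
          linarith
    intro A hAS hA
    refine (aux N A hAS (hA.trans_le (by
      rw [pow_succ']
      exact Nat.mul_le_mul_right _ (by omega)))).trans (le_of_eq ?_)
    field_simp
    ring

/-- Summation over level sets of the weight `w`. -/
lemma subadditive_le_of_sum_rpow_le (h0 : Ψ ∅ ≤ 0)
    (hadd : ∀ A B, Disjoint A B → Ψ (A ∪ B) ≤ Ψ A + Ψ B) {N : ℕ} {x y s : ℝ}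
    (hx : 1 < x) (hy : 0 < y) (hxy : x * y < 1) (hs : 0 < s) (hys : y ^ s * N = 1)
    {S : Finset ι} {w : ι → ℝ} (hw : ∀ i ∈ S, 0 < w i) (hw1 : ∑ i ∈ S, w i ^ s ≤ 1)
    (hS : ∀ t, 0 ≤ t → ∀ v, ∀ A ⊆ S, A.card = N ^ v → (∀ i ∈ A, w i ≤ t) → Ψ A ≤ t * x ^ v) :
    Ψ S ≤ N / (x - 1) * x / (1 - x * y) := by
  have hx' : 0 < x - 1 := by linarith
  have hx0 : 0 < x := by linarith
  have hxy' : 0 < 1 - x * y := by linarith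
  have hy1 : y < 1 := by nlinarith
  set D : ℝ := N / (x - 1) * x / (1 - x * y) with hD
  have hD0 : 0 ≤ D := by positivity
  have hwle : ∀ i ∈ S, w i ≤ 1 := fun i hi => by
    by_contra hcon
    have h₁ := Finset.single_le_sum (f := fun i => w i ^ s)
      (fun i hi => Real.rpow_nonneg (hw i hi).le s) hi
    have h₂ := Real.one_lt_rpow (not_le.1 hcon) hs
    linarith
  have key : ∀ J : ℕ, ∀ A ⊆ S, (∀ i ∈ A, y ^ J < w i) → Ψ A ≤ D * (1 - (x * y) ^ J) := by
    intro J
    induction J with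
    | zero =>
      intro A hAS hA
      have : A = ∅ := Finset.eq_empty_of_forall_notMem fun i hi => by
        have h₁ := hA i hi
        have h₂ := hwle i (hAS hi)
        rw [pow_zero] at h₁
        linarith
      simpa [this] using h0
    | succ J ih =>
      intro A hAS hA
      set R := A.filter fun i => ¬ y ^ J < w i with hR
      have hRS : R ⊆ S := (Finset.filter_subset _ _).trans hAS
      have hsplit := hadd (A.filter fun i => y ^ J < w i) R
        (Finset.disjoint_filter_filter_not A A _)
      rw [Finset.filter_union_filter_not_eq] at hsplit
      have h₁ := ih (A.filter fun i => y ^ J < w i) ((Finset.filter_subset _ _).trans hAS)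
        fun i hi => (Finset.mem_filter.1 hi).2
      have hcard : R.card < N ^ (J + 1) := by
        by_contra hcon
        have hpow : (y ^ (J + 1)) ^ s * (N : ℝ) ^ (J + 1) = 1 := by
          rw [← Real.rpow_natCast y, ← Real.rpow_mul hy.le, mul_comm ((J + 1 : ℕ) : ℝ) s,
            Real.rpow_mul hy.le, Real.rpow_natCast, ← mul_pow, hys, one_pow]
        have hN : 0 < N := Nat.pos_of_ne_zero fun h => by simp [h] at hys
        have hRne : R.Nonempty := Finset.card_pos.1 ((pow_pos hN _).trans_le (not_lt.1 hcon))
        have h₂ : ∑ _i ∈ R, (y ^ (J + 1)) ^ s < ∑ i ∈ R, w i ^ s :=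
          Finset.sum_lt_sum_of_nonempty hRne fun i hi =>
            Real.rpow_lt_rpow (by positivity) (hA i (Finset.mem_filter.1 hi).1) hs
        have h₃ : ∑ i ∈ R, w i ^ s ≤ ∑ i ∈ S, w i ^ s :=
          Finset.sum_le_sum_of_subset_of_nonneg hRS fun i hi _ =>
            Real.rpow_nonneg (hw i hi).le s
        have h₄ : ((N ^ (J + 1) : ℕ) : ℝ) ≤ R.card := by exact_mod_cast not_lt.1 hcon
        rw [Finset.sum_const, nsmul_eq_mul] at h₂
        push_cast at h₄
        have h₅ : 0 < (y ^ (J + 1)) ^ s := by positivity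
        nlinarith
      have h₂ := subadditive_le_of_card_lt h0 hadd hx (by positivity : 0 ≤ y ^ J)
        (S := R) (fun v B hBR hB => hS (y ^ J) (by positivity) v B (hBR.trans hRS) hB fun i hi =>
          not_lt.1 (Finset.mem_filter.1 (hBR hi)).2) (J + 1) R subset_rfl hcard
      refine hsplit.trans ((add_le_add h₁ h₂).trans (le_of_eq ?_))
      rw [hD]
      field_simp
      ring
  obtain ⟨J, hJ⟩ : ∃ J : ℕ, ∀ i ∈ S, y ^ J < w i := by
    rcases S.eq_empty_or_nonempty with rfl | hne
    · exact ⟨0, by simp⟩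
    · obtain ⟨i, hi, hmin⟩ := S.exists_min_image w hne
      obtain ⟨J, hJ⟩ := exists_pow_lt_of_lt_one (hw i hi) hy1
      exact ⟨J, fun l hl => hJ.trans_le (hmin l hl)⟩
  refine (key J S subset_rfl hJ).trans ?_
  have : 0 ≤ (x * y) ^ J := by positivity
  nlinarith

end Combinatorics

/-- Proposition 2.7(v): if `E` is an identity block, `N > 1` and
`1 ≤ p ≤ r < ∞` satisfy `τ_{r,N}(E) ≤ N^{1/p − 1/r}`, then `E` has block type `s`
for every `1 ≤ s < p`, i.e. `sup_n τ_{s,n}(E) < ∞`. -/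
theorem block_type_of_tau_bound {𝕜 : Type*} [RCLike 𝕜]
    (ca cb : ℝ) (hca : 0 ≤ ca) (hcb : 1 ≤ cb)
    (E : Fam 𝕜) (hE : IdentityBlockFam ca cb E)
    (N : ℕ) (hN : 1 < N) (p r : ℝ) (hp : 1 ≤ p) (hpr : p ≤ r)
    (hτ : tauC (ENNReal.ofReal r) E N ≤ (N : ℝ) ^ (1 / p - 1 / r)) :
    ∀ s : ℝ, 1 ≤ s → s < p →
      ∃ C : ℝ, ∀ n : ℕ, 1 ≤ n → tauC (ENNReal.ofReal s) E n ≤ C := by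
  intro s hs hsp
  have hs0 : 0 < s := by linarith
  have hp0 : 0 < p := by linarith
  have hr1 : 1 ≤ r := by linarith
  have hr0 : 0 < r := by linarith
  have hN1 : (1 : ℝ) < N := by exact_mod_cast hN
  have hN0 : (0 : ℝ) < N := by linarith
  set K : ℝ := ((N : ℝ) ^ (1 / p - 1 / r)) ^ r with hKdef
  have hK0 : 0 ≤ K := by positivity
  set x : ℝ := (N : ℝ) ^ (1 / p) with hx
  set y : ℝ := (N : ℝ) ^ (-(1 / s)) with hy
  have hx1 : 1 < x := Real.one_lt_rpow hN1 (by positivity)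
  have hx0 : 0 < x := by linarith
  have hy0 : 0 < y := by positivity
  have hxy : x * y < 1 := by
    rw [hx, hy, ← Real.rpow_add hN0]
    refine Real.rpow_lt_one_of_one_lt_of_neg hN1 ?_
    have := one_div_lt_one_div_of_lt hs0 hsp
    linarith
  have hys : y ^ s * N = 1 := by
    rw [hy, ← Real.rpow_mul hN0.le, neg_mul, one_div_mul_cancel hs0.ne', Real.rpow_neg_one,
      inv_mul_cancel₀ hN0.ne']
  have hKN : K * N = x ^ r := by
    rw [hKdef, hx, ← Real.rpow_mul hN0.le, ← Real.rpow_mul hN0.le, ← Real.rpow_add_one hN0.ne']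
    congr 1
    field_simp
    ring
  have hK : ∀ Q ∈ E N, ∀ b : Fin N → 𝕜,
      ∑ δ : Fin N → Bool, Q.2 (fun j => sgn (δ j) * b j) ^ r ≤
        2 ^ N * (K * ∑ j, ‖b j‖ ^ r) := fun Q hQ b => by
    have h := (radLp_le_tauC_mul hE hr1 hQ b).trans
      (mul_le_mul_of_nonneg_right hτ (lpnorm_nonneg hr0.le b))
    have h' := Real.rpow_le_rpow (radLp_nonneg hr0.le _) h hr0.le
    rw [radLp_rpow hr0, Real.mul_rpow (by positivity) (lpnorm_nonneg hr0.le b), lpnorm_rpow hr0,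
      div_le_iff₀' (by positivity)] at h'
    simpa only [abs_of_nonneg (apply_nonneg Q.2 _)] using h'
  set D : ℝ := N / (x - 1) * x / (1 - x * y) with hD
  have hD0 : 0 < D := by
    have : 0 < x - 1 := by linarith
    have : 0 < 1 - x * y := by linarith
    positivity
  have hunit : ∀ n : ℕ, ∀ P ∈ E n, ∀ a : Fin n → 𝕜, ∑ i, ‖a i‖ ^ s ≤ 1 →
      radLp (ENNReal.ofReal s) (fun ε => P.2 (fun i => sgn (ε i) * a i)) ≤ D := by
    intro n P hP a ha
    set Ψ : Finset (Fin n) → ℝ := fun A =>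
      radLp (ENNReal.ofReal r) (fun ε => P.2 (restr A fun i => sgn (ε i) * a i)) with hΨ
    set S : Finset (Fin n) := Finset.univ.filter fun i => a i ≠ 0 with hS
    have hΨS : Ψ S = radLp (ENNReal.ofReal r) (fun ε => P.2 (fun i => sgn (ε i) * a i)) := by
      have : ∀ ε : Fin n → Bool, (restr S fun i => sgn (ε i) * a i) =
          fun i => sgn (ε i) * a i := fun ε => by
        funext i
        by_cases h : a i = 0 <;> simp [restr, hS, h]
      simp only [hΨ, this]
    refine (radLp_le_radLp hs0 (hsp.le.trans hpr) _).trans (hΨS ▸ ?_)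
    have hchunk : ∀ t, 0 ≤ t → ∀ v, ∀ A ⊆ S, A.card = N ^ v → (∀ i ∈ A, ‖a i‖ ≤ t) →
        Ψ A ≤ t * x ^ v := by
      intro t ht v A hAS hA hAt
      have h := sum_restr_rpow_le hE (by omega) hK0 hK hP a v A hA fun i hi =>
        (Finset.mem_filter.1 (hAS hi)).2
      have hsum : ∑ i ∈ A, ‖a i‖ ^ r ≤ (N : ℝ) ^ v * t ^ r := by
        calc ∑ i ∈ A, ‖a i‖ ^ r ≤ ∑ _i ∈ A, t ^ r :=
              Finset.sum_le_sum fun i hi => Real.rpow_le_rpow (norm_nonneg _) (hAt i hi) hr0.le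
          _ = (N : ℝ) ^ v * t ^ r := by simp [hA]
      rw [← Real.rpow_le_rpow_iff (radLp_nonneg hr0.le _) (by positivity) hr0, radLp_rpow hr0,
        div_le_iff₀' (by positivity)]
      simp only [abs_of_nonneg (apply_nonneg P.2 _)]
      refine h.trans ?_
      gcongr
      calc K ^ v * ∑ i ∈ A, ‖a i‖ ^ r ≤ K ^ v * ((N : ℝ) ^ v * t ^ r) := by gcongr
        _ = (t * x ^ v) ^ r := by
          rw [← mul_assoc, ← mul_pow, hKN, Real.mul_rpow ht (by positivity), mul_comm,
            ← Real.rpow_natCast, ← Real.rpow_natCast, ← Real.rpow_mul hx0.le,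
            ← Real.rpow_mul hx0.le, mul_comm r]
    refine subadditive_le_of_sum_rpow_le (w := fun i => ‖a i‖) ?_ ?_ hx1 hy0 hxy hs0 hys ?_ ?_
      hchunk
    · have : ∀ ε : Fin n → Bool, P.2 (restr ∅ fun i => sgn (ε i) * a i) = 0 := fun ε => by
        rw [← map_zero P.2]
        congr 1
      simp only [hΨ, this]
      exact (radLp_const hr0 n le_rfl).le
    · intro A B hAB
      refine (radLp_mono hr0.le (fun ε => apply_nonneg _ _) fun ε => ?_).trans
        (radLp_add_le hr1 (fun ε => apply_nonneg _ _) fun ε => apply_nonneg _ _)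
      refine le_of_eq_of_le (congrArg P.2 ?_) (map_add_le_add P.2 _ _)
      funext i
      have hdisj : i ∈ A → i ∉ B := fun h => Finset.disjoint_left.1 hAB h
      by_cases h₁ : i ∈ A <;> by_cases h₂ : i ∈ B <;> simp_all [restr]
    · intro i hi
      exact norm_pos_iff.2 (Finset.mem_filter.1 hi).2
    · exact (Finset.sum_le_sum_of_subset_of_nonneg (Finset.subset_univ S)
        fun _ _ _ => by positivity).trans ha
  refine ⟨D, fun n _ => csInf_le ⟨0, fun T hT => hT.1.le⟩ ⟨hD0, fun P hP a => ?_⟩⟩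
  set L : ℝ := lpnorm (ENNReal.ofReal s) a with hL
  rcases (lpnorm_nonneg hs0.le a).eq_or_lt with h0 | hpos
  · have ha : ∀ i, a i = 0 := fun i =>
      norm_le_zero_iff.1 ((norm_le_lpnorm hs0 a i).trans_eq h0.symm)
    have hz : ∀ ε : Fin n → Bool, P.2 (fun i => sgn (ε i) * a i) = 0 := fun ε => by
      rw [← map_zero P.2]
      congr 1
      funext i
      simp [ha]
    simp only [hz]
    rw [radLp_const hs0 n le_rfl]
    exact mul_nonneg hD0.le (lpnorm_nonneg hs0.le a)
  · change 0 < L at hpos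
    have hLs : ∑ i, ‖((L : 𝕜)⁻¹) * a i‖ ^ s ≤ 1 := by
      simp only [norm_mul, norm_inv, RCLike.norm_ofReal, abs_of_pos hpos]
      simp only [Real.mul_rpow (inv_nonneg.2 hpos.le) (norm_nonneg _)]
      rw [← Finset.mul_sum, ← lpnorm_rpow hs0, Real.inv_rpow hpos.le,
        inv_mul_cancel₀ (Real.rpow_pos_of_pos hpos s).ne']
    have hLne : (L : 𝕜) ≠ 0 := by exact_mod_cast hpos.ne'
    have hscale : ∀ ε : Fin n → Bool, P.2 (fun i => sgn (ε i) * a i) =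
        L * P.2 (fun i => sgn (ε i) * ((L : 𝕜)⁻¹ * a i)) := fun ε => by
      have : (fun i => sgn (ε i) * a i) =
          (L : 𝕜) • fun i => sgn (ε i) * ((L : 𝕜)⁻¹ * a i) := by
        funext i
        simp only [Pi.smul_apply, smul_eq_mul]
        field_simp
      rw [this, map_smul_eq_mul, RCLike.norm_ofReal, abs_of_pos hpos]
    simp only [hscale]
    rw [radLp_const_mul hs0 hpos.le, mul_comm]
    exact mul_le_mul_of_nonneg_right (hunit n P hP _ hLs) hpos.le

end AsymSeminorms
end
end

section
/- Let a ≥ 0, b ≥ 1 and let E ⊆ ⋃_{n≥1} B_n^{a,b} be an identity block. If N > 1 is an integer and 1 ≤ r ≤ q < ∞ are such that γ_{r,N}(E) ≤ N^{1/r − 1/q}, then for every q < s < ∞ one has sup_n γ_{s,n}(E) < ∞ (that is, E has block cotype s). -/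
open scoped BigOperators ENNReal

noncomputable section

namespace AsymSeminorms

section

variable {𝕜 : Type*} [RCLike 𝕜]

/-- Block closedness in the form of an existence statement: a normalised block sequence of a
member of `E` spans a member of `E`. -/
lemma exists_block {ca cb : ℝ} {E : Fam 𝕜} (hE : StableFam ca cb E) {n m : ℕ}
    {P : SNPair 𝕜 n} (hP : P ∈ E n) (a : Fin n → 𝕜) (k : Fin (m + 1) → ℕ) (hk0 : k 0 = 0)
    (hk : StrictMono k) (hkn : k (Fin.last m) ≤ n) (hnorm : ∀ j, P.1 (piece a k j) = 1) :
    ∃ Q ∈ E m, ∀ b : Fin m → 𝕜, Q.1 b = P.1 (∑ j, b j • piece a k j) := by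
  let L : (Fin m → 𝕜) →ₗ[𝕜] (Fin n → 𝕜) := Fintype.linearCombination 𝕜 (piece a k)
  have hL : ∀ b, L b = ∑ j, b j • piece a k j := fun b => rfl
  have hmem := hE.1 n P hP
  have hloc : ∀ (b : Fin m → 𝕜) (j : Fin m) (i : Fin n), piece a k j i ≠ 0 →
      L b i = b j * piece a k j i := by
    intro b j i hi
    rw [hL, Finset.sum_apply, Finset.sum_eq_single j]
    · simp
    · intro j' _ hj'
      have hij : k j.castSucc ≤ (i : ℕ) ∧ (i : ℕ) < k j.succ := by
        by_contra h
        exact hi (by simp [piece, h])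
      have : piece a k j' i = 0 := by
        refine if_neg fun h => ?_
        rcases lt_or_gt_of_ne hj' with h' | h'
        · have : k j'.succ ≤ k j.castSucc := hk.monotone (by
            rw [Fin.le_def]; simp; exact h')
          omega
        · have : k j.succ ≤ k j'.castSucc := hk.monotone (by
            rw [Fin.le_def]; simp; exact h')
          omega
      simp [this]
    · simp
  have htrunc : ∀ l (hl : l ≤ m) (b : Fin m → 𝕜),
      L (trunc l b) = trunc (k ⟨l, Nat.lt_succ_of_le hl⟩) (L b) := by
    intro l hl b
    ext i
    simp only [hL, trunc, Finset.sum_apply, Pi.smul_apply, smul_eq_mul]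
    have hterm : ∀ j : Fin m, (if (j : ℕ) < l then b j else 0) * piece a k j i =
        if (i : ℕ) < k ⟨l, Nat.lt_succ_of_le hl⟩ then b j * piece a k j i else 0 := by
      intro j
      by_cases hij : k j.castSucc ≤ (i : ℕ) ∧ (i : ℕ) < k j.succ
      · by_cases hjl : (j : ℕ) < l
        · have : k j.succ ≤ k ⟨l, Nat.lt_succ_of_le hl⟩ := hk.monotone (by
            rw [Fin.le_def]; simp; exact hjl)
          rw [if_pos hjl, if_pos (by omega)]
        · have : k ⟨l, Nat.lt_succ_of_le hl⟩ ≤ k j.castSucc := hk.monotone (by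
            rw [Fin.le_def]; simp; omega)
          rw [if_neg hjl, if_neg (by omega), zero_mul]
      · simp [piece, hij]
    rw [Finset.sum_congr rfl fun j _ => hterm j]
    split_ifs <;> simp
  let Q : SNPair 𝕜 m := (P.1.comp L, P.2.comp L)
  have hkl : ∀ l (hl : l ≤ m), k ⟨l, Nat.lt_succ_of_le hl⟩ ≤ n := fun l hl =>
    (hk.monotone (Fin.le_last _)).trans hkn
  refine ⟨Q, hE.2.2 n m P hP Q ?_ ⟨a, k, hk0, hk, hkn, hnorm, fun _ => rfl, fun _ => rfl⟩,
    fun _ => rfl⟩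
  refine ⟨fun b hb => ?_, fun j => ?_, fun l hl b => ?_, fun l hl b => ?_, fun b => ?_⟩
  · have h0 : L b = 0 := hmem.eq_zero_of _ hb
    funext j
    have hne : piece a k j ≠ 0 := fun h => by simpa [h] using hnorm j
    obtain ⟨i, hi⟩ := Function.ne_iff.1 hne
    have := hloc b j i hi
    rw [h0] at this
    exact (mul_eq_zero.1 this.symm).resolve_right hi
  · change P.1 (L (Pi.single j 1)) = 1
    rw [← hnorm j, Fintype.linearCombination_apply_single, one_smul]
  · change P.1 (L (trunc l b)) ≤ cb * P.1 (L b)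
    rw [htrunc l hl]
    exact hmem.trunc_fst _ (hkl l hl) _
  · change P.2 (L (trunc l b)) ≤ cb * P.2 (L b)
    rw [htrunc l hl]
    exact hmem.trunc_snd _ (hkl l hl) _
  · exact hmem.snd_le _

/-- Subsequences of members of a stable family are members of the family. -/
lemma exists_subseq {ca cb : ℝ} {E : Fam 𝕜} (hE : StableFam ca cb E) {n m : ℕ}
    {P : SNPair 𝕜 n} (hP : P ∈ E n) (f : Fin m → Fin n) (hf : StrictMono f) :
    ∃ Q ∈ E m, ∀ b : Fin m → 𝕜, Q.1 b = P.1 (∑ j, Pi.single (f j) (b j)) := by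
  classical
  let a : Fin n → 𝕜 := fun i => if i ∈ Set.range f then 1 else 0
  let k : Fin (m + 1) → ℕ := Fin.cases 0 fun j => f j + 1
  have hpiece : ∀ j, piece a k j = Pi.single (f j) 1 := by
    intro j
    ext i
    have hlow : ∀ j' : Fin m, k j.castSucc ≤ f j' ↔ j ≤ j' := by
      intro j'
      rcases m with _ | m
      · exact j.elim0
      refine Fin.cases ?_ (fun j₀ => ?_) j
      · simp [k]
      · rw [Fin.castSucc_succ]
        simp only [k, Fin.cases_succ]
        rw [Nat.succ_le_iff, Fin.val_fin_lt, hf.lt_iff_lt, Fin.castSucc_lt_iff_succ_le]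
    have hup : ∀ j' : Fin m, (f j' : ℕ) < k j.succ ↔ j' ≤ j := by
      intro j'
      simp only [k, Fin.cases_succ]
      rw [Nat.lt_succ_iff, Fin.val_fin_le, hf.le_iff_le]
    by_cases hi : i ∈ Set.range f
    · obtain ⟨j', rfl⟩ := hi
      by_cases hjj : j' = j
      · subst hjj
        simp [piece, hlow, hup, a]
      · rw [Pi.single_eq_of_ne (hf.injective.ne hjj)]
        refine if_neg fun h => hjj ?_
        rw [hlow, hup] at h
        exact le_antisymm h.2 h.1
    · rw [Pi.single_eq_of_ne (fun h => hi ⟨j, h.symm⟩)]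
      have : a i = 0 := if_neg hi
      simp [piece, this]
  have hk : StrictMono k := by
    refine Fin.strictMono_iff_lt_succ.2 fun j => ?_
    rcases m with _ | m
    · exact j.elim0
    refine Fin.cases ?_ (fun j₀ => ?_) j
    · exact Nat.succ_pos _
    · rw [Fin.castSucc_succ]
      simp only [k, Fin.cases_succ]
      have : f j₀.castSucc < f j₀.succ := hf (Fin.castSucc_lt_succ)
      rw [Fin.lt_def] at this
      omega
  have hkn : k (Fin.last m) ≤ n := by
    rcases m with _ | m
    · simp [k]
    · rw [← Fin.succ_last]
      simp only [k, Fin.cases_succ]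
      exact (f (Fin.last m)).2
  have hnorm : ∀ j, P.1 (piece a k j) = 1 := fun j => by
    rw [hpiece]
    exact (hE.1 n P hP).single_eq_one _
  obtain ⟨Q, hQ, h⟩ := exists_block hE hP a k rfl hk hkn hnorm
  refine ⟨Q, hQ, fun b => ?_⟩
  rw [h]
  congr 1
  refine Finset.sum_congr rfl fun j _ => ?_
  rw [hpiece, ← Pi.single_smul, smul_eq_mul, mul_one]

open Finset in
/-- Marginals of the uniform measure on a power are uniform. -/
lemma expect_comp_injective {ι κ X : Type*} [Fintype ι] [Fintype κ] [Fintype X] [DecidableEq ι]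
    [DecidableEq κ] [Nonempty X] (f : κ → ι) (hf : Function.Injective f) (g : (κ → X) → ℝ) :
    (𝔼 η : ι → X, g (fun j => η (f j))) = 𝔼 η : κ → X, g η := by
  classical
  let e := Equiv.piEquivPiSubtypeProd (fun i => i ∈ Set.range f) (fun _ : ι => X)
  let e' : ({i // i ∈ Set.range f} → X) ≃ (κ → X) :=
    (Equiv.ofInjective f hf).symm.arrowCongr (Equiv.refl X)
  have he : (𝔼 η : ι → X, g (fun j => η (f j))) = 𝔼 p, g (e' (p : _ × _).1) :=
    Fintype.expect_equiv e _ (fun p => g (e' p.1)) fun η => rfl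
  rw [he, ← univ_product_univ, expect_product]
  simp only [Fintype.expect_const]
  exact Fintype.expect_equiv e' _ _ fun _ => rfl

lemma sgn_mul_sgn (b c : Bool) : (sgn b : 𝕜) * sgn c = sgn (b == c) := by
  cases b <;> cases c <;> simp [sgn]

open Finset in
/-- Invariance of the Rademacher measure under sign changes. -/
lemma expect_beq {ι : Type*} [Fintype ι] [DecidableEq ι] (δ : ι → Bool) (g : (ι → Bool) → ℝ) :
    (𝔼 ε : ι → Bool, g (fun i => δ i == ε i)) = 𝔼 ε : ι → Bool, g ε := by
  refine Fintype.expect_bijective (fun ε i => δ i == ε i) ?_ _ _ fun _ => rfl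
  refine Function.Involutive.bijective fun ε => ?_
  funext i
  dsimp only
  cases δ i <;> cases ε i <;> rfl

open Finset in
/-- The `r`-th moment of the Rademacher sum with coefficients `a` with respect to `p`. -/
def radMoment {n : ℕ} (p : Seminorm 𝕜 (Fin n → 𝕜)) (r : ℝ) (a : Fin n → 𝕜) : ℝ :=
  𝔼 ε : Fin n → Bool, p (fun i => sgn (ε i) * a i) ^ r

lemma radMoment_nonneg {n : ℕ} (p : Seminorm 𝕜 (Fin n → 𝕜)) (r : ℝ) (a : Fin n → 𝕜) :
    0 ≤ radMoment p r a :=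
  Finset.expect_nonneg fun _ _ => Real.rpow_nonneg (apply_nonneg p _) _

lemma radLp_ofReal_s7 {n : ℕ} (p : Seminorm 𝕜 (Fin n → 𝕜)) {r : ℝ} (hr : 0 ≤ r) (a : Fin n → 𝕜) :
    radLp (ENNReal.ofReal r) (fun ε => p (fun i => sgn (ε i) * a i)) =
      radMoment p r a ^ (1 / r) := by
  simp [radLp, radMoment, Fintype.expect_eq_sum_div_card, ENNReal.toReal_ofReal hr,
    abs_of_nonneg (apply_nonneg p _)]

/-- The defining inequality of `gammaC`, stated without roots. -/
lemma lpnorm_le_mul_radLp_iff {ca cb : ℝ} {n : ℕ} {P : SNPair 𝕜 n} (hP : MemB ca cb P)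
    (hid : P.1 = P.2) {r : ℝ} (hr : 0 < r) {C : ℝ} (hC : 0 ≤ C) (a : Fin n → 𝕜) :
    lpnorm (ENNReal.ofReal r) (fun i => a i * ((P.2 (Pi.single i 1) : ℝ) : 𝕜)) ≤
        C * radLp (ENNReal.ofReal r) (fun ε => P.1 (fun i => sgn (ε i) * a i)) ↔
      ∑ i, ‖a i‖ ^ r ≤ C ^ r * radMoment P.1 r a := by
  have h0 : 0 ≤ ∑ i, ‖a i‖ ^ r := Finset.sum_nonneg fun i _ => by positivity
  have h1 := radMoment_nonneg P.1 r a
  rw [radLp_ofReal_s7 _ hr.le, ← hid]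
  simp only [hP.single_eq_one, RCLike.ofReal_one, mul_one, lpnorm, ENNReal.ofReal_ne_top,
    if_false, ENNReal.toReal_ofReal hr.le]
  rw [← Real.rpow_le_rpow_iff (by positivity) (by positivity) hr,
    Real.mul_rpow hC (by positivity), ← Real.rpow_mul h0, ← Real.rpow_mul h1,
    one_div_mul_cancel hr.ne', Real.rpow_one, Real.rpow_one]

lemma norm_coord_le {ca cb : ℝ} {n : ℕ} {P : SNPair 𝕜 n} (hP : MemB ca cb P)
    (a : Fin n → 𝕜) (i : Fin n) : ‖a i‖ ≤ 2 * cb * P.1 a := by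
  have h : a i • Pi.single i (1 : 𝕜) = trunc (i + 1) a - trunc i a := by
    ext j
    by_cases hj : j = i
    · subst hj
      simp [trunc]
    · have : (j : ℕ) ≠ i := fun h => hj (Fin.ext h)
      simp only [Pi.smul_apply, Pi.single_eq_of_ne hj, smul_zero, Pi.sub_apply, trunc]
      split_ifs <;> first | omega | simp
  have h2 := map_sub_le_add P.1 (trunc (i + 1) a) (trunc i a)
  rw [← h, map_smul_eq_mul, hP.single_eq_one, mul_one] at h2
  linarith [hP.trunc_fst (i + 1) i.2 a, hP.trunc_fst i i.2.le a]

/-- The root-free lower estimate with constant `c` for coefficients without zeros. -/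
def HasLowerMoment (E : Fam 𝕜) (r : ℝ) (n : ℕ) (c : ℝ) : Prop :=
  ∀ P ∈ E n, ∀ a : Fin n → 𝕜, (∀ i, a i ≠ 0) → ∑ i, ‖a i‖ ^ r ≤ c * radMoment P.1 r a

lemma hasLowerMoment_of_gammaC_le {ca cb : ℝ} (hcb : 1 ≤ cb) {E : Fam 𝕜}
    (hE : IdentityBlockFam ca cb E) {n : ℕ} {r B : ℝ} (hr : 0 < r) (hB : 0 ≤ B)
    (h : gammaC (ENNReal.ofReal r) E n ≤ B) : HasLowerMoment E r n (B ^ r) := by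
  intro P hP a _
  have hmem := hE.1.1 n
  have hcb0 : (0 : ℝ) < cb := by linarith
  rw [← lpnorm_le_mul_radLp_iff (hmem P hP) (hE.2 n P hP) hr hB]
  set S := {C : ℝ | 0 < C ∧ ∀ P ∈ E n, ∀ a : Fin n → 𝕜,
    lpnorm (ENNReal.ofReal r) (fun i => a i * ((P.2 (Pi.single i 1) : ℝ) : 𝕜)) ≤
      C * radLp (ENNReal.ofReal r) (fun ε => P.1 (fun i => sgn (ε i) * a i))} with hS
  have hne : S.Nonempty := by
    refine ⟨((n : ℝ) + 1) ^ (1 / r) * (2 * cb), by positivity, fun P hP a => ?_⟩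
    rw [lpnorm_le_mul_radLp_iff (hmem P hP) (hE.2 n P hP) hr (by positivity),
      Real.mul_rpow (by positivity) (by positivity), ← Real.rpow_mul (by positivity),
      one_div_mul_cancel hr.ne', Real.rpow_one, radMoment, Finset.mul_expect]
    refine Finset.le_expect Finset.univ_nonempty fun ε _ => ?_
    have hnn := apply_nonneg P.1 (fun i => sgn (ε i) * a i)
    have hi : ∀ i, ‖a i‖ ^ r ≤ (2 * cb) ^ r * P.1 (fun i => sgn (ε i) * a i) ^ r := by
      intro i
      rw [← Real.mul_rpow (by positivity) hnn]
      refine Real.rpow_le_rpow (norm_nonneg _) ?_ hr.le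
      simpa [norm_sgn] using norm_coord_le (hmem P hP) (fun i => sgn (ε i) * a i) i
    refine (Finset.sum_le_sum fun i _ => hi i).trans ?_
    rw [Finset.sum_const, Finset.card_univ, Fintype.card_fin, nsmul_eq_mul, mul_assoc]
    exact mul_le_mul_of_nonneg_right (by linarith) (by positivity)
  have hrad : 0 ≤ radLp (ENNReal.ofReal r) (fun ε => P.1 (fun i => sgn (ε i) * a i)) := by
    rw [radLp_ofReal_s7 _ hr.le]
    exact Real.rpow_nonneg (radMoment_nonneg _ _ _) _
  have key : ∀ ε > 0, lpnorm (ENNReal.ofReal r)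
      (fun i => a i * ((P.2 (Pi.single i 1) : ℝ) : 𝕜)) ≤
      (B + ε) * radLp (ENNReal.ofReal r) (fun ε => P.1 (fun i => sgn (ε i) * a i)) := by
    intro ε hε
    obtain ⟨C, hC, hlt⟩ := exists_lt_of_csInf_lt hne (lt_of_le_of_lt h (lt_add_of_pos_right B hε))
    exact (hC.2 P hP a).trans (mul_le_mul_of_nonneg_right hlt.le hrad)
  set l := lpnorm (ENNReal.ofReal r) (fun i => a i * ((P.2 (Pi.single i 1) : ℝ) : 𝕜))
  set R := radLp (ENNReal.ofReal r) (fun ε => P.1 (fun i => sgn (ε i) * a i))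
  refine ge_of_tendsto (f := fun ε => (B + ε) * R) (x := nhdsWithin 0 (Set.Ioi 0)) ?_
    (Filter.eventually_of_mem self_mem_nhdsWithin key)
  refine Filter.Tendsto.mono_left ?_ nhdsWithin_le_nhds
  have : Continuous fun ε => (B + ε) * R := by fun_prop
  simpa using this.tendsto 0

open Finset in
/-- Submultiplicativity of the lower moment constants. -/
lemma HasLowerMoment.mul {ca cb : ℝ} {E : Fam 𝕜} (hE : StableFam ca cb E) {m n : ℕ} (hn : 0 < n)
    {r c d : ℝ} (hd0 : 0 ≤ d) (hc : HasLowerMoment E r m c)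
    (hd : HasLowerMoment E r n d) : HasLowerMoment E r (m * n) (d * c) := by
  classical
  intro P hP a ha
  have hmem := hE.1 _ P hP
  let y (J : Fin m) (ε : Fin (m * n) → Bool) : Fin (m * n) → 𝕜 :=
    fun i => if i.divNat = J then sgn (ε i) * a i else 0
  have hyi : ∀ J ε i, y J ε i = if i.divNat = J then sgn (ε i) * a i else 0 :=
    fun _ _ _ => rfl
  have hsgn : ∀ b : Bool, (sgn b : 𝕜) ≠ 0 := fun b => norm_ne_zero_iff.1 (by simp [norm_sgn])
  have hy : ∀ J ε, P.1 (y J ε) ≠ 0 := by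
    intro J ε h
    have := congrFun (hmem.eq_zero_of _ h) (finProdFinEquiv (J, ⟨0, hn⟩))
    have hJ : (finProdFinEquiv (J, (⟨0, hn⟩ : Fin n))).divNat = J :=
      congrArg Prod.fst (finProdFinEquiv.symm_apply_apply (J, (⟨0, hn⟩ : Fin n)))
    simp [y, hJ, hsgn, ha] at this
  have hsup : ∀ ε, ∑ J, P.1 (y J ε) ^ r ≤ c * 𝔼 δ : Fin m → Bool,
      P.1 (fun i => sgn (δ i.divNat == ε i) * a i) ^ r := by
    intro ε
    let a' : Fin (m * n) → 𝕜 := fun i =>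
      ((P.1 (y i.divNat ε) : ℝ) : 𝕜)⁻¹ * (sgn (ε i) * a i)
    let k : Fin (m + 1) → ℕ := fun j => j * n
    have hpiece : ∀ J, piece a' k J = ((P.1 (y J ε) : ℝ) : 𝕜)⁻¹ • y J ε := by
      intro J
      ext i
      have hi : (k J.castSucc ≤ (i : ℕ) ∧ (i : ℕ) < k J.succ) ↔ i.divNat = J := by
        simp only [k, Fin.ext_iff, Fin.val_castSucc, Fin.val_succ, Fin.coe_divNat]
        rw [Nat.div_eq_iff hn, Nat.add_mul]
        omega
      simp only [piece, hi, y, Pi.smul_apply, smul_eq_mul]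
      split_ifs with h
      · subst h; rfl
      · simp
    obtain ⟨Q, hQ, h⟩ := exists_block hE hP a' k (by simp [k])
      (fun i j hij => Nat.mul_lt_mul_of_pos_right hij hn) (by simp [k]) (fun J => by
        rw [hpiece, map_smul_eq_mul, norm_inv, RCLike.norm_ofReal,
          abs_of_nonneg (apply_nonneg _ _), inv_mul_cancel₀ (hy J ε)])
    have h2 := hc Q hQ (fun J => ((P.1 (y J ε) : ℝ) : 𝕜)) fun J => by
      simpa using hy J ε
    simp only [RCLike.norm_ofReal, abs_of_nonneg (apply_nonneg P.1 _)] at h2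
    refine h2.trans (le_of_eq ?_)
    simp only [radMoment, h]
    congr 1
    refine expect_congr rfl fun δ _ => ?_
    congr 2
    ext i
    simp only [hpiece, smul_smul, Finset.sum_apply, Pi.smul_apply, smul_eq_mul, hyi]
    rw [Finset.sum_eq_single i.divNat]
    · have : ((P.1 (y i.divNat ε) : ℝ) : 𝕜) ≠ 0 := by simpa using hy i.divNat ε
      simp only [if_true]
      rw [← sgn_mul_sgn, mul_assoc (sgn _) _ (_⁻¹), mul_inv_cancel₀ this, mul_one, mul_assoc]
    · intro J _ hJ
      simp [hJ.symm]
    · simp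
  have hsub : ∀ J, ∑ i : Fin n, ‖a (finProdFinEquiv (J, i))‖ ^ r ≤
      d * 𝔼 ε, P.1 (y J ε) ^ r := by
    intro J
    let f : Fin n → Fin (m * n) := fun i => finProdFinEquiv (J, i)
    have hf : StrictMono f := fun i j hij => by
      exact Nat.add_lt_add_right hij _
    obtain ⟨Q, hQ, h⟩ := exists_subseq hE hP f hf
    refine (hd Q hQ (fun i => a (f i)) fun i => ha _).trans (le_of_eq ?_)
    rw [radMoment, ← expect_comp_injective f hf.injective
      (fun η => Q.1 (fun i => sgn (η i) * a (f i)) ^ r)]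
    congr 1
    refine expect_congr rfl fun ε _ => ?_
    rw [h]
    congr 2
    ext i
    obtain ⟨⟨J', i'⟩, rfl⟩ := finProdFinEquiv.surjective i
    have hJ : (finProdFinEquiv (J', i')).divNat = J' :=
      congrArg Prod.fst (finProdFinEquiv.symm_apply_apply (J', i'))
    simp only [hyi, hJ, Finset.sum_apply, Pi.single_apply, f, finProdFinEquiv.injective.eq_iff,
      Prod.mk.injEq]
    by_cases hJJ : J' = J
    · subst hJJ; simp
    · simp [hJJ]
  rw [← finProdFinEquiv.sum_comp, Fintype.sum_prod_type]
  calc ∑ J, ∑ i, ‖a (finProdFinEquiv (J, i))‖ ^ r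
      ≤ ∑ J, d * 𝔼 ε, P.1 (y J ε) ^ r := sum_le_sum fun J _ => hsub J
    _ = d * 𝔼 ε, ∑ J, P.1 (y J ε) ^ r := by rw [← mul_sum, expect_sum_comm]
    _ ≤ d * 𝔼 ε : Fin (m * n) → Bool, c * 𝔼 δ : Fin m → Bool,
          P.1 (fun i => sgn (δ i.divNat == ε i) * a i) ^ r :=
        mul_le_mul_of_nonneg_left (expect_le_expect fun ε _ => hsup ε) hd0
    _ = d * c * radMoment P.1 r a := by
        rw [← mul_expect, expect_comm, mul_assoc]
        congr 2
        have : ∀ δ : Fin m → Bool, (𝔼 ε : Fin (m * n) → Bool,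
            P.1 (fun i => sgn (δ i.divNat == ε i) * a i) ^ r) = radMoment P.1 r a := fun δ =>
          expect_beq (fun i => δ i.divNat) fun ε => P.1 (fun i => sgn (ε i) * a i) ^ r
        simp only [this]
        exact Fintype.expect_const _

lemma hasLowerMoment_one {ca cb : ℝ} {E : Fam 𝕜} (hE : SubB ca cb E) (r : ℝ) :
    HasLowerMoment E r 1 1 := by
  intro P hP a _
  have h : ∀ ε : Fin 1 → Bool, P.1 (fun i => sgn (ε i) * a i) = ‖a 0‖ := by
    intro ε
    have : (fun i => sgn (ε i) * a i) = (sgn (ε 0) * a 0) • Pi.single (0 : Fin 1) (1 : 𝕜) := by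
      ext i
      rw [Subsingleton.elim i 0]
      simp
    rw [this, map_smul_eq_mul, (hE 1 P hP).single_eq_one, norm_mul, norm_sgn, one_mul, mul_one]
  simp [radMoment, h]

lemma HasLowerMoment.pow {ca cb : ℝ} {E : Fam 𝕜} (hE : StableFam ca cb E) {N : ℕ} (hN : 0 < N)
    {r c : ℝ} (hc0 : 0 ≤ c) (hc : HasLowerMoment E r N c) (k : ℕ) :
    HasLowerMoment E r (N ^ k) (c ^ k) := by
  induction k with
  | zero => simpa using hasLowerMoment_one hE.1 r
  | succ k ih =>
    rw [pow_succ, pow_succ']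
    exact HasLowerMoment.mul hE hN hc0 ih hc

open Finset in
/-- Restricting a Rademacher sum to a subsequence does not increase its moments. -/
lemma radMoment_subseq_le {m n : ℕ} (p : Seminorm 𝕜 (Fin n → 𝕜)) {r : ℝ} (hr : 1 ≤ r)
    (a : Fin n → 𝕜) (f : Fin m → Fin n) (hf : Function.Injective f) :
    (𝔼 η : Fin m → Bool, p (∑ j, Pi.single (f j) (sgn (η j) * a (f j))) ^ r) ≤
      radMoment p r a := by
  classical
  let δ : Fin n → Bool := fun i => decide (i ∈ Set.range f)
  have hpt : ∀ ε : Fin n → Bool, p (∑ j, Pi.single (f j) (sgn (ε (f j)) * a (f j))) ^ r ≤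
      2⁻¹ * p (fun i => sgn (ε i) * a i) ^ r +
        2⁻¹ * p (fun i => sgn (δ i == ε i) * a i) ^ r := by
    intro ε
    have hsum : ∑ j, Pi.single (f j) (sgn (ε (f j)) * a (f j)) =
        (2⁻¹ : 𝕜) • ((fun i => sgn (ε i) * a i) + fun i => sgn (δ i == ε i) * a i) := by
      ext i
      simp only [Finset.sum_apply, Pi.smul_apply, Pi.add_apply, smul_eq_mul, ← sgn_mul_sgn]
      by_cases hi : i ∈ Set.range f
      · obtain ⟨j, rfl⟩ := hi
        rw [sum_eq_single j (fun j' _ hj' => by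
          rw [Pi.single_eq_of_ne (hf.ne hj'.symm)]) (by simp)]
        simp only [Pi.single_eq_same, δ, Set.mem_range_self, decide_true, sgn, if_true, one_mul]
        ring
      · rw [sum_eq_zero fun j _ => by
          rw [Pi.single_eq_of_ne fun h => hi ⟨j, h.symm⟩]]
        have hδ : δ i = false := decide_eq_false hi
        cases ε i <;> simp [hδ, sgn]
    rw [hsum, map_smul_eq_mul]
    have h2 : ‖(2⁻¹ : 𝕜)‖ = 2⁻¹ := by simp
    rw [h2]
    set u := p (fun i => sgn (ε i) * a i)
    set v := p (fun i => sgn (δ i == ε i) * a i)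
    have hu : 0 ≤ u := apply_nonneg p _
    have hv : 0 ≤ v := apply_nonneg p _
    calc _ ≤ (2⁻¹ * u + 2⁻¹ * v) ^ r := by
          refine Real.rpow_le_rpow (by positivity) ?_ (by linarith)
          rw [← mul_add]
          exact mul_le_mul_of_nonneg_left (map_add_le_add p _ _) (by norm_num)
      _ ≤ _ := by
          simpa using (convexOn_rpow hr).2 (Set.mem_Ici.2 hu) (Set.mem_Ici.2 hv)
            (by norm_num : (0 : ℝ) ≤ 2⁻¹) (by norm_num : (0 : ℝ) ≤ 2⁻¹) (by norm_num)
  rw [← expect_comp_injective f hf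
    (fun η => p (∑ j, Pi.single (f j) (sgn (η j) * a (f j))) ^ r)]
  refine (expect_le_expect fun ε _ => hpt ε).trans (le_of_eq ?_)
  rw [expect_add_distrib, ← mul_expect, ← mul_expect,
    expect_beq δ fun ε => p (fun i => sgn (ε i) * a i) ^ r, radMoment]
  ring

open Finset in
/-- A weak `ℓ_q` bound gives a strong `ℓ_s` bound for `s > q`. -/
lemma sum_rpow_le_of_weak {n : ℕ} (f : Fin n → ℝ) (hf : ∀ i, 0 ≤ f i) {q s D : ℝ} (hq : 0 < q)
    (hqs : q < s) (hD : 0 ≤ D)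
    (h : ∀ t : ℝ, 0 < t → (#{i | t ≤ f i} : ℝ) * t ^ q ≤ D) :
    ∑ i, f i ^ s ≤ D ^ (s / q) * ∑' k : ℕ, 1 / ((k : ℝ) + 1) ^ (s / q) := by
  have hs : 0 < s := hq.trans hqs
  have hsq : 1 < s / q := (one_lt_div hq).2 hqs
  let σ := Tuple.sort fun i => -f i
  have hσ : Antitone (f ∘ σ) := fun i j hij => neg_le_neg_iff.1 (Tuple.monotone_sort (fun i => -f i) hij)
  have hterm : ∀ j : Fin n, f (σ j) ^ s ≤ D ^ (s / q) * (1 / ((j : ℝ) + 1) ^ (s / q)) := by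
    intro j
    rcases (hf (σ j)).eq_or_lt with h0 | h0
    · rw [← h0, Real.zero_rpow hs.ne']
      positivity
    have hcard : (j : ℕ) + 1 ≤ #{i | f (σ j) ≤ f i} := by
      calc (j : ℕ) + 1 = #((Finset.Iic j).map σ.toEmbedding) := by simp
        _ ≤ _ := card_le_card fun i hi => by
          obtain ⟨j', hj', rfl⟩ := mem_map.1 hi
          simpa using hσ (mem_Iic.1 hj')
    have h1 : f (σ j) ^ q ≤ D / ((j : ℝ) + 1) := by
      rw [le_div_iff₀' (by positivity)]
      refine le_trans ?_ (h _ h0)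
      gcongr
      exact_mod_cast hcard
    calc f (σ j) ^ s = (f (σ j) ^ q) ^ (s / q) := by
          rw [← Real.rpow_mul h0.le, mul_div_cancel₀ _ hq.ne']
      _ ≤ (D / ((j : ℝ) + 1)) ^ (s / q) := by gcongr
      _ = _ := by rw [Real.div_rpow hD (by positivity), div_eq_mul_one_div]
  have hsummable : Summable fun k : ℕ => 1 / ((k : ℝ) + 1) ^ (s / q) := by
    simpa using (summable_nat_add_iff 1).2 (Real.summable_one_div_nat_rpow.2 hsq)
  rw [← Equiv.sum_comp σ]
  refine (sum_le_sum fun j _ => hterm j).trans ?_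
  rw [← mul_sum]
  refine mul_le_mul_of_nonneg_left ?_ (by positivity)
  rw [Fin.sum_univ_eq_sum_range (fun k => 1 / ((k : ℝ) + 1) ^ (s / q)) n]
  exact hsummable.sum_le_tsum _ fun k _ => by positivity

open Finset in
/-- The moments of a Rademacher sum satisfy Jensen's inequality. -/
lemma radMoment_rpow_le {n : ℕ} (p : Seminorm 𝕜 (Fin n → 𝕜)) {r s : ℝ} (hr : 0 < r)
    (hrs : r ≤ s) (a : Fin n → 𝕜) : radMoment p r a ^ (s / r) ≤ radMoment p s a := by
  have h := Real.rpow_arith_mean_le_arith_mean_rpow (univ : Finset (Fin n → Bool))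
    (fun _ => (Fintype.card (Fin n → Bool) : ℝ)⁻¹)
    (fun ε => p (fun i => sgn (ε i) * a i) ^ r) (fun _ _ => by positivity)
    (by rw [sum_const, card_univ, nsmul_eq_mul]; exact mul_inv_cancel₀ (by simp))
    (fun _ _ => Real.rpow_nonneg (apply_nonneg p _) _) ((one_le_div hr).2 hrs)
  simp only [← mul_sum, ← Real.rpow_mul (apply_nonneg p _), mul_div_cancel₀ s hr.ne'] at h
  simpa only [radMoment, Fintype.expect_eq_sum_div_card, div_eq_inv_mul] using h

open Finset in
/-- The weak `ℓ_q` estimate obtained by iterating a lower moment estimate of length `N`. -/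
lemma card_mul_rpow_le {ca cb : ℝ} {E : Fam 𝕜} (hE : StableFam ca cb E) {N : ℕ} (hN : 1 < N)
    {r q : ℝ} (hr : 1 ≤ r) (hrq : r ≤ q)
    (hc : HasLowerMoment E r N (((N : ℝ) ^ (1 / r - 1 / q)) ^ r)) {n : ℕ} {P : SNPair 𝕜 n}
    (hP : P ∈ E n) (a : Fin n → 𝕜) {t : ℝ} (ht : 0 < t) :
    (#{i | t ≤ ‖a i‖} : ℝ) * t ^ q ≤ N * radMoment P.1 r a ^ (q / r) := by
  have hr0 : 0 < r := by linarith
  have hq0 : 0 < q := by linarith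
  have hN0 : (0 : ℝ) < N := by exact_mod_cast hN.pos
  have hR := radMoment_nonneg P.1 r a
  set A : Finset (Fin n) := {i | t ≤ ‖a i‖} with hA
  rcases Nat.eq_zero_or_pos #A with h0 | hpos
  · rw [h0, Nat.cast_zero, zero_mul]
    positivity
  set k := Nat.log N #A
  have hle : N ^ k ≤ #A := Nat.pow_log_le_self N hpos.ne'
  have hlt : #A < N ^ (k + 1) := Nat.lt_pow_succ_log_self hN _
  let f : Fin (N ^ k) → Fin n := fun j => A.orderEmbOfFin rfl (Fin.castLE hle j)
  have hf : StrictMono f := fun i j hij => (A.orderEmbOfFin rfl).strictMono hij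
  have hfA : ∀ j, t ≤ ‖a (f j)‖ := fun j =>
    (mem_filter.1 (A.orderEmbOfFin_mem rfl (Fin.castLE hle j))).2
  obtain ⟨Q, hQ, h⟩ := exists_subseq hE hP f hf
  have h1 := HasLowerMoment.pow hE hN.pos (by positivity) hc k Q hQ (fun j => a (f j))
    fun j => norm_pos_iff.1 (ht.trans_le (hfA j))
  have h2 : radMoment Q.1 r (fun j => a (f j)) ≤ radMoment P.1 r a := by
    simp only [radMoment, h]
    exact radMoment_subseq_le P.1 hr a f hf.injective
  set M : ℝ := (N : ℝ) ^ k with hM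
  have hM0 : 0 < M := by positivity
  have h3 : M * t ^ r ≤ M ^ (1 - r / q) * radMoment P.1 r a := by
    calc M * t ^ r = ∑ _j : Fin (N ^ k), t ^ r := by simp [hM]
      _ ≤ ∑ j, ‖a (f j)‖ ^ r := sum_le_sum fun j _ => by
          have := hfA j
          gcongr
      _ ≤ _ := h1
      _ = M ^ (1 - r / q) * radMoment Q.1 r (fun j => a (f j)) := by
          congr 1
          rw [hM, ← Real.rpow_mul hN0.le, ← Real.rpow_natCast, ← Real.rpow_natCast,
            ← Real.rpow_mul hN0.le, ← Real.rpow_mul hN0.le]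
          congr 1
          field_simp
      _ ≤ _ := by gcongr
  have h4 : M ^ (r / q) * t ^ r ≤ radMoment P.1 r a := by
    rw [Real.rpow_sub hM0, Real.rpow_one, div_mul_eq_mul_div, le_div_iff₀ (by positivity)] at h3
    refine le_of_mul_le_mul_left ?_ hM0
    linarith
  have h5 : M * t ^ q ≤ radMoment P.1 r a ^ (q / r) := by
    have := Real.rpow_le_rpow (by positivity) h4 (by positivity : 0 ≤ q / r)
    rwa [Real.mul_rpow (by positivity) (by positivity), ← Real.rpow_mul hM0.le,
      ← Real.rpow_mul ht.le, div_mul_div_cancel₀ hq0.ne', div_self hr0.ne', Real.rpow_one,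
      mul_div_cancel₀ _ hr0.ne'] at this
  calc (#A : ℝ) * t ^ q ≤ (N * M) * t ^ q := by
        gcongr
        rw [hM, ← pow_succ']
        exact_mod_cast hlt.le
    _ = N * (M * t ^ q) := by ring
    _ ≤ _ := by gcongr

end

/-- Proposition 2.7(vii): if `E` is an identity block, `N > 1` and
`1 ≤ r ≤ q < ∞` satisfy `γ_{r,N}(E) ≤ N^{1/r − 1/q}`, then `E` has block cotype `s`
for every `q < s < ∞`, i.e. `sup_n γ_{s,n}(E) < ∞`. -/
theorem block_cotype_of_gamma_bound {𝕜 : Type*} [RCLike 𝕜]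
    (ca cb : ℝ) (hca : 0 ≤ ca) (hcb : 1 ≤ cb)
    (E : Fam 𝕜) (hE : IdentityBlockFam ca cb E)
    (N : ℕ) (hN : 1 < N) (r q : ℝ) (hr : 1 ≤ r) (hrq : r ≤ q)
    (hγ : gammaC (ENNReal.ofReal r) E N ≤ (N : ℝ) ^ (1 / r - 1 / q)) :
    ∀ s : ℝ, q < s →
      ∃ C : ℝ, ∀ n : ℕ, 1 ≤ n → gammaC (ENNReal.ofReal s) E n ≤ C := by
  intro s hqs
  have hr0 : 0 < r := by linarith
  have hq0 : 0 < q := by linarith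
  have hs0 : 0 < s := by linarith
  have hc := hasLowerMoment_of_gammaC_le hcb hE hr0 (by positivity) hγ
  set K : ℝ := (N : ℝ) ^ (s / q) * ∑' k : ℕ, 1 / ((k : ℝ) + 1) ^ (s / q)
  have hK : 0 ≤ K := mul_nonneg (by positivity) (tsum_nonneg fun k => by positivity)
  refine ⟨(K + 1) ^ (1 / s), fun n _ => csInf_le ⟨0, fun C hC => hC.1.le⟩
    ⟨by positivity, fun P hP a => ?_⟩⟩
  rw [lpnorm_le_mul_radLp_iff (hE.1.1 n P hP) (hE.2 n P hP) hs0 (by positivity),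
    ← Real.rpow_mul (by positivity), one_div_mul_cancel hs0.ne', Real.rpow_one]
  have hR := radMoment_nonneg P.1 r a
  calc ∑ i, ‖a i‖ ^ s
      ≤ (N * radMoment P.1 r a ^ (q / r)) ^ (s / q) *
          ∑' k : ℕ, 1 / ((k : ℝ) + 1) ^ (s / q) :=
        sum_rpow_le_of_weak _ (fun i => norm_nonneg _) hq0 hqs (by positivity)
          fun t ht => card_mul_rpow_le hE.1 hN hr hrq hc hP a ht
    _ = K * radMoment P.1 r a ^ (s / r) := by
        have : q / r * (s / q) = s / r := by field_simp
        rw [Real.mul_rpow (by positivity) (by positivity), ← Real.rpow_mul hR, this]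
        ring
    _ ≤ (K + 1) * radMoment P.1 s a := by
        gcongr
        · linarith
        · exact radMoment_rpow_le P.1 hr0 (by linarith) a

end AsymSeminorms
end
end
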